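/- Suppose b satisfies Assumption 1 with ρ ∈ (1,2), adopt the spectral setup and the finite element setup, and assume the Ritz projection error bound holds. Then there exists C > 0, independent of h and x, such that for every s with 0 ≤ s ≤ 2 and every x ∈ H: ∫₀^∞ ‖S(t)x − S_h(t)P_h x‖² dt ≤ C h^{2s} ‖x‖²_{s − 1/ρ}. -/

import Mathlib

open MeasureTheory Filter Set
open scoped ENNReal NNReal RealInnerProductSpace

noncomputable section

/-- The Laplace transform `b̂(z) = ∫₀^∞ e^{-zt} b(t) dt` of a real-valued kernel `b`. -/
def laplaceTransform (b : ℝ → ℝ) (z : ℂ) : ℂ :=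
  ∫ t in Set.Ioi (0 : ℝ), Complex.exp (-z * t) * (b t : ℂ)

/-- Assumption 1: `b` is a nonzero, locally integrable, 3-monotone kernel
(with derivative `b'` on `(0,∞)`), `b(t) → 0` as `t → ∞`, and the angle condition
`ρ = 1 + (2/π) sup{|arg b̂(λ)| : Re λ > 0} ∈ (1,2)` holds. -/
structure Assumption1 (b b' : ℝ → ℝ) (ρ : ℝ) : Prop where
  locInt : ∀ T > 0, IntegrableOn b (Set.Ioc 0 T)
  ne_zero : ∃ t > 0, b t ≠ 0
  nonneg : ∀ t > 0, 0 ≤ b t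
  anti : AntitoneOn b (Set.Ioi 0)
  cvx : ConvexOn ℝ (Set.Ioi 0) b
  hasDeriv : ∀ t > 0, HasDerivAt b (b' t) t
  deriv_nonpos : ∀ t > 0, b' t ≤ 0
  deriv_anti : AntitoneOn (fun t => -(b' t)) (Set.Ioi 0)
  deriv_cvx : ConvexOn ℝ (Set.Ioi 0) (fun t => -(b' t))
  tendsto_zero : Tendsto b atTop (nhds 0)
  rho_eq : ρ = 1 + (2 / Real.pi) *
      sSup {θ : ℝ | ∃ z : ℂ, 0 < z.re ∧ θ = |(laplaceTransform b z).arg|}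
  rho_mem : ρ ∈ Set.Ioo (1 : ℝ) 2

/-- Assumption 2: `b̂` extends analytically to a sector `Σ_θ`, `θ > π/2`, with the
bounds `|b̂^{(k)}(z)| ≤ C |z|^{1-ρ-k}`, `k = 0,1`, there. -/
structure Assumption2 (b : ℝ → ℝ) (ρ θ : ℝ) : Prop where
  theta_gt : Real.pi / 2 < θ
  holo : ∃ B : ℂ → ℂ,
    (∀ z : ℂ, z ≠ 0 → |z.arg| < θ → DifferentiableAt ℂ B z) ∧
    (∀ z : ℂ, 0 < z.re → B z = laplaceTransform b z) ∧
    ∃ C > 0, (∀ z : ℂ, z ≠ 0 → |z.arg| < θ → ‖B z‖ ≤ C * ‖z‖ ^ (1 - ρ)) ∧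
      (∀ z : ℂ, z ≠ 0 → |z.arg| < θ → ‖deriv B z‖ ≤ C * ‖z‖ ^ (-ρ))

/-- `s` (with derivative `s'` on `(0,∞)`) solves the scalar Volterra equation
`s'(t) + λ ∫₀ᵗ b(t-u) s(u) du = 0`, `s(0) = 1`. -/
structure IsScalarSolution (b : ℝ → ℝ) (lam : ℝ) (s s' : ℝ → ℝ) : Prop where
  init : s 0 = 1
  cont : ContinuousOn s (Set.Ici 0)
  hasDeriv : ∀ t > 0, HasDerivAt s (s' t) t
  eqn : ∀ t > 0, s' t + lam * ∫ u in (0 : ℝ)..t, b (t - u) * s u = 0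

/-- The resolvent family `S(t)x = Σ_k s_k(t) (x,e_k) e_k`. -/
def Sop {H : Type*} [NormedAddCommGroup H] [InnerProductSpace ℝ H]
    (e : HilbertBasis ℕ ℝ H) (s : ℕ → ℝ → ℝ) (t : ℝ) (x : H) : H :=
  ∑' k, (s k t * ⟪x, e k⟫) • (e k : H)

/-- The Backward Euler convolution quadrature operator
`B_k = ∫₀^∞ F(Δt s) e^{-s} s^{k-1}/(k-1)! ds`. -/
def quadB {H : Type*} [NormedAddCommGroup H] [NormedSpace ℝ H]
    (Δt : ℝ) (F : ℝ → H) (k : ℕ) : H :=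
  ∫ u in Set.Ioi (0 : ℝ),
    (Real.exp (-u) * u ^ (k - 1) / (Nat.factorial (k - 1) : ℝ)) • F (Δt * u)

/-- The finite element setup: `f` is an orthonormal basis of the finite dimensional
subspace `V_h ⊆ D(A^{1/2})`, consisting of eigenvectors of the discrete operator `A_h`
(defined via the bilinear form `a(u,v) = Σ_k λ_k (u,e_k)(v,e_k)`) with positive
eigenvalues `μ`. -/
structure FESetup {H : Type*} [NormedAddCommGroup H] [InnerProductSpace ℝ H]
    (e : HilbertBasis ℕ ℝ H) (lam : ℕ → ℝ) (N : ℕ) (f : Fin N → H) (μ : Fin N → ℝ) :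
    Prop where
  f_orth : Orthonormal ℝ f
  mu_pos : ∀ j, 0 < μ j
  f_dom : ∀ j, (∑' k, ENNReal.ofReal (lam k * ⟪f j, e k⟫ ^ 2)) < ⊤
  eigen : ∀ j j', (∑' k, lam k * ⟪f j, e k⟫ * ⟪f j', e k⟫) = μ j * ⟪f j, f j'⟫

open FourierTransform in
/-- **Plancherel's theorem** for functions in `L¹ ∩ L²`. -/
theorem eLpNorm_fourier_eq_of_integrable {f : ℝ → ℂ} (h1 : Integrable f) (h2 : MemLp f 2) :
    eLpNorm (𝓕 f) 2 volume = eLpNorm f 2 volume := by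
  have hcont : Continuous (𝓕 f) :=
    VectorFourier.fourierIntegral_continuous (μ := volume) (L := innerₗ ℝ)
      Real.continuous_fourierChar (by exact continuous_inner) h1
  set F : Lp (α := ℝ) ℂ 2 volume := h2.toLp f with hF
  have key : ∀ᵐ x, 𝓕 f x = (𝓕 F : Lp (α := ℝ) ℂ 2 volume) x := by
    refine ae_eq_of_integral_contDiff_smul_eq hcont.locallyIntegrable
      ((Lp.memLp _).locallyIntegrable (by norm_num)) ?_
    intro g hg hgs
    have hgs' : HasCompactSupport (fun x => (g x : ℂ)) := hgs.comp_left (g := fun r : ℝ => (r : ℂ)) rfl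
    have hg' : ContDiff ℝ (⊤ : ℕ∞) (fun x => (g x : ℂ)) := Complex.ofRealCLM.contDiff.comp hg
    let φ : SchwartzMap ℝ ℂ := hgs'.toSchwartzMap hg'
    have hφ : ∀ x, φ x = (g x : ℂ) := fun x => rfl
    have e1 := congrArg (fun T => T φ) (Lp.fourier_toTemperedDistribution_eq F)
    simp only [TemperedDistribution.fourier_apply, Lp.toTemperedDistribution_apply] at e1
    have e2 : ∫ x, (𝓕 φ) x • F x = ∫ x, (𝓕 φ) x • f x := by
      refine integral_congr_ae ?_
      filter_upwards [h2.coeFn_toLp] with x hx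
      rw [hF, hx]
    have e3 : ∫ x, (𝓕 (φ : ℝ → ℂ)) x • f x = ∫ x, φ x • 𝓕 f x := by
      have := VectorFourier.integral_fourierIntegral_smul_eq_flip (μ := volume) (ν := volume)
        (L := innerₗ ℝ) Real.continuous_fourierChar (by exact continuous_inner) φ.integrable h1
      rw [flip_innerₗ] at this
      exact this
    rw [e2] at e1
    have e4 : ∫ x, (𝓕 φ) x • f x = ∫ x, (𝓕 (φ : ℝ → ℂ)) x • f x := by
      simp only [SchwartzMap.fourier_coe]
    rw [e4, e3] at e1
    simpa [hφ] using e1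
  rw [eLpNorm_congr_ae key]
  have := Lp.norm_fourier_eq F
  rw [Lp.norm_def, Lp.norm_def, ENNReal.toReal_eq_toReal_iff' (Lp.eLpNorm_ne_top _) (Lp.eLpNorm_ne_top _)] at this
  rw [this, hF]
  exact eLpNorm_congr_ae h2.coeFn_toLp

open FourierTransform in
theorem laplaceTransform_eq_fourier (f : ℝ → ℝ) (ε ω : ℝ) :
    laplaceTransform f (ε + ω * Complex.I) =
      𝓕 ((Ioi (0 : ℝ)).indicator fun t => ((Real.exp (-ε * t) * f t : ℝ) : ℂ))
        ((2 * Real.pi)⁻¹ * ω) := by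
  rw [Real.fourier_eq', laplaceTransform, ← integral_indicator measurableSet_Ioi]
  refine integral_congr_ae (.of_forall fun t => ?_)
  by_cases ht : t ∈ Ioi (0 : ℝ)
  · simp only [indicator_of_mem ht, smul_eq_mul]
    push_cast
    rw [← mul_assoc, ← Complex.exp_add]
    congr 2
    have : (Real.pi : ℂ) ≠ 0 := by exact_mod_cast Real.pi_ne_zero
    simp
    field_simp
  · simp [indicator_of_notMem ht]

theorem continuous_laplaceTransform_vertical {f : ℝ → ℝ} {ε : ℝ}
    (h1 : IntegrableOn (fun t => Real.exp (-ε * t) * f t) (Ioi 0)) :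
    Continuous fun ω : ℝ => laplaceTransform f (ε + ω * Complex.I) := by
  simp_rw [laplaceTransform_eq_fourier]
  refine Continuous.comp (g := FourierTransform.fourier _) ?_ (by fun_prop)
  refine VectorFourier.fourierIntegral_continuous (μ := volume) (L := innerₗ ℝ)
      Real.continuous_fourierChar (by exact continuous_inner) ?_
  rw [integrable_indicator_iff measurableSet_Ioi]
  exact Integrable.ofReal h1

theorem lintegral_comp_inv_mul {c : ℝ} (hc : 0 < c) {F : ℝ → ℝ≥0∞} (hF : Measurable F) :
    ∫⁻ ω, F (c⁻¹ * ω) = ENNReal.ofReal c * ∫⁻ ω, F ω := by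
  have h := Real.smul_map_volume_mul_left (a := c⁻¹) (by positivity)
  have h2 : ∫⁻ ω, F (c⁻¹ * ω) = ∫⁻ ω, F ω ∂(Measure.map (c⁻¹ * ·) volume) := by
    rw [lintegral_map hF (by fun_prop)]
  rw [h2]
  conv_rhs => rw [← h]
  rw [lintegral_smul_measure, smul_eq_mul, ← mul_assoc, abs_of_pos (by positivity),
    ← ENNReal.ofReal_mul hc.le, mul_inv_cancel₀ hc.ne']
  simp

/-- Plancherel's theorem for Laplace transforms on a vertical line. -/
theorem lintegral_enorm_laplaceTransform_sq {f : ℝ → ℝ} {ε : ℝ}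
    (h1 : IntegrableOn (fun t => Real.exp (-ε * t) * f t) (Ioi 0))
    (h2 : MemLp (fun t => Real.exp (-ε * t) * f t) 2 (volume.restrict (Ioi 0))) :
    ∫⁻ ω : ℝ, ‖laplaceTransform f (ε + ω * Complex.I)‖ₑ ^ 2 =
      ENNReal.ofReal (2 * Real.pi) *
        ∫⁻ t in Ioi (0 : ℝ), ENNReal.ofReal ((Real.exp (-ε * t) * f t) ^ 2) := by
  set g : ℝ → ℂ := (Ioi (0 : ℝ)).indicator fun t => ((Real.exp (-ε * t) * f t : ℝ) : ℂ) with hg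
  have hg1 : Integrable g := by
    rw [integrable_indicator_iff measurableSet_Ioi]
    exact Integrable.ofReal h1
  have hg2 : MemLp g 2 := by
    rw [hg, memLp_indicator_iff_restrict measurableSet_Ioi]
    exact h2.ofReal
  have hcont : Continuous (FourierTransform.fourier g) :=
    VectorFourier.fourierIntegral_continuous (μ := volume) (L := innerₗ ℝ)
      Real.continuous_fourierChar (by exact continuous_inner) hg1
  simp_rw [laplaceTransform_eq_fourier]
  rw [lintegral_comp_inv_mul (by positivity) (F := fun w => ‖FourierTransform.fourier g w‖ₑ ^ 2)
    (by fun_prop)]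
  congr 1
  have h := eLpNorm_fourier_eq_of_integrable hg1 hg2
  have hsq : ∀ u : ℝ → ℂ, eLpNorm u 2 volume ^ 2 = ∫⁻ x, ‖u x‖ₑ ^ 2 := by
    intro u
    have := eLpNorm_nnreal_pow_eq_lintegral (μ := volume) (f := u) (p := 2) (by norm_num)
    simpa using this
  rw [← hsq, h, hsq, ← lintegral_indicator measurableSet_Ioi]
  refine lintegral_congr fun t => ?_
  by_cases ht : t ∈ Ioi (0 : ℝ)
  · simp only [hg, indicator_of_mem ht]
    rw [← sq_abs, ← Real.norm_eq_abs, ENNReal.ofReal_pow (norm_nonneg _), ofReal_norm]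
    congr 1
    rw [← ofReal_norm, ← ofReal_norm, Complex.norm_real]
  · simp [hg, indicator_of_notMem ht]

theorem integrableOn_sin_mul {γ : ℝ → ℝ} {S : Set ℝ} (h : IntegrableOn γ S) :
    IntegrableOn (fun t => Real.sin t * γ t) S := by
  refine Integrable.bdd_mul (c := 1) h (by fun_prop) ?_
  exact .of_forall fun t => by simpa using Real.abs_sin_le_one t

theorem integrableOn_cos_mul {γ : ℝ → ℝ} {S : Set ℝ} (h : IntegrableOn γ S) :
    IntegrableOn (fun t => Real.cos t * γ t) S := by
  refine Integrable.bdd_mul (c := 1) h (by fun_prop) ?_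
  exact .of_forall fun t => by simpa using Real.abs_cos_le_one t

theorem integral_Ioi_shift (g : ℝ → ℝ) (a : ℝ) :
    ∫ t in Ioi a, g t = ∫ t in Ioi 0, g (t + a) := by
  have h := (measurePreserving_add_right volume a).setIntegral_preimage_emb
    (measurableEmbedding_addRight a) g (Ioi a)
  rw [← h]
  congr 2
  ext t; simp

theorem IntegrableOn.shift_Ioi {g : ℝ → ℝ} {a : ℝ} (ha : 0 ≤ a) (h : IntegrableOn g (Ioi 0)) :
    IntegrableOn (fun t => g (t + a)) (Ioi 0) := by
  have h2 := (measurePreserving_add_right volume a).integrableOn_comp_preimage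
    (measurableEmbedding_addRight a) (f := g) (s := Ioi a)
  have h3 : (fun t => t + a) ⁻¹' (Ioi a) = Ioi 0 := by ext t; simp
  rw [h3] at h2
  exact h2.2 (h.mono_set (Ioi_subset_Ioi ha))

/-- The sine integral of a nonincreasing integrable function is nonnegative. -/
theorem integral_sin_mul_nonneg {γ : ℝ → ℝ} (ha : AntitoneOn γ (Ioi 0))
    (hi : IntegrableOn γ (Ioi 0)) : 0 ≤ ∫ t in Ioi 0, Real.sin t * γ t := by
  have hint := integrableOn_sin_mul hi
  have hii : ∀ a b : ℝ, 0 ≤ a → 0 ≤ b →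
      IntervalIntegrable (fun t => Real.sin t * γ t) volume a b := fun a b h1 h2 =>
    intervalIntegrable_iff.2 (hint.mono_set fun x hx => lt_of_le_of_lt (le_min h1 h2) hx.1)
  have hstep : ∀ n : ℕ, 0 ≤ ∫ t in (0 : ℝ)..(2 * Real.pi * n), Real.sin t * γ t := by
    intro n
    induction n with
    | zero => simp
    | succ n ih =>
      have hpi := Real.pi_pos
      have h0 : 0 ≤ 2 * Real.pi * n := by positivity
      rw [← intervalIntegral.integral_add_adjacent_intervals
        (hii 0 (2 * Real.pi * n) le_rfl h0) (hii _ _ h0 (by positivity))]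
      refine add_nonneg ih ?_
      rw [← intervalIntegral.integral_add_adjacent_intervals
        (hii (2 * Real.pi * n) (2 * Real.pi * n + Real.pi) h0 (by positivity))
        (hii _ _ (by positivity) (by positivity))]
      have e : (2 * Real.pi * ((n + 1 : ℕ) : ℝ)) = 2 * Real.pi * n + Real.pi + Real.pi := by
        push_cast; ring
      rw [e, ← intervalIntegral.integral_comp_add_right (fun t => Real.sin t * γ t) Real.pi,
        ← intervalIntegral.integral_add (hii _ _ h0 (by positivity)) ?_]
      · rw [intervalIntegral.integral_of_le (by linarith)]
        refine setIntegral_nonneg measurableSet_Ioc fun t ht => ?_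
        have ht0 : 0 < t := lt_of_le_of_lt h0 ht.1
        have hs : 0 ≤ Real.sin t := by
          have : Real.sin t = Real.sin (t - n * (2 * Real.pi)) := by
            rw [Real.sin_sub_nat_mul_two_pi]
          rw [this]
          exact Real.sin_nonneg_of_nonneg_of_le_pi (by linarith [ht.1]) (by linarith [ht.2])
        have := ha (a := t) (b := t + Real.pi) ht0 (by simp; linarith) (by linarith)
        rw [Real.sin_add_pi]
        nlinarith
      · have := (hii (2 * Real.pi * n + Real.pi) (2 * Real.pi * n + Real.pi + Real.pi)
          (by positivity) (by positivity)).comp_add_right Real.pi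
        simpa using this
  have hlim : Tendsto (fun n : ℕ => ∫ t in (0 : ℝ)..(2 * Real.pi * n), Real.sin t * γ t) atTop
      (nhds (∫ t in Ioi 0, Real.sin t * γ t)) := by
    refine intervalIntegral_tendsto_integral_Ioi 0 hint ?_
    exact tendsto_natCast_atTop_atTop.const_mul_atTop (by positivity)
  exact ge_of_tendsto' hlim hstep

theorem antitoneOn_sub_shift {β : ℝ → ℝ} (hc : ConvexOn ℝ (Ioi 0) β) {a : ℝ} (ha : 0 < a) :
    AntitoneOn (fun t => β t - β (t + a)) (Ioi 0) := by
  intro s hs t ht hst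
  rcases eq_or_lt_of_le hst with rfl | hst
  · rfl
  have hs : 0 < s := hs
  have ht : 0 < t := ht
  have h1 := hc.secant_mono (a := s) (x := s + a) (y := t + a) hs (by simp; linarith) (by simp; linarith)
    (by linarith) (by linarith) (by linarith)
  have h2 := hc.secant_mono (a := t + a) (x := s) (y := t) (by simp; linarith) hs ht
    (by linarith) (by linarith) (by linarith)
  rw [← neg_div_neg_eq, ← neg_div_neg_eq (β t - _)] at h2
  simp only [neg_sub] at h2
  rw [add_sub_cancel_left] at h1 h2
  have h3 := h1.trans (by convert h2 using 1)
  rw [div_le_div_iff_of_pos_right ha] at h3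
  simp only
  linarith

theorem setIntegral_Ioi_split {g : ℝ → ℝ} {a : ℝ} (ha : 0 ≤ a) (h : IntegrableOn g (Ioi 0)) :
    ∫ t in Ioi 0, g t = (∫ t in Ioc 0 a, g t) + ∫ t in Ioi 0, g (t + a) := by
  rw [← integral_Ioi_shift, ← setIntegral_union (Set.Ioc_disjoint_Ioi le_rfl) measurableSet_Ioi
    (h.mono_set Ioc_subset_Ioi_self) (h.mono_set (Ioi_subset_Ioi ha)), Ioc_union_Ioi_eq_Ioi ha]

theorem integral_cos_add_sin_ge {β : ℝ → ℝ} (hn : ∀ t > 0, 0 ≤ β t) (ha : AntitoneOn β (Ioi 0))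
    (hc : ConvexOn ℝ (Ioi 0) β) (hi : IntegrableOn β (Ioi 0)) :
    (1 / 2) * ∫ t in Ioc 0 1, β t ≤
      (∫ t in Ioi 0, Real.cos t * β t) + 4 * ∫ t in Ioi 0, Real.sin t * β t := by
  have hpi := Real.pi_pos
  have hpi3 := Real.pi_gt_three
  have hsin := integrableOn_sin_mul hi
  have hcos := integrableOn_cos_mul hi
  -- the sine integral
  have hs : (1 / 2) * β (Real.pi / 2) ≤ ∫ t in Ioi 0, Real.sin t * β t := by
    have h1 := setIntegral_Ioi_split hpi.le hsin
    simp only [Real.sin_add_pi] at h1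
    have h2 := integral_sin_mul_nonneg (antitoneOn_sub_shift hc hpi)
      (hi.sub (IntegrableOn.shift_Ioi hpi.le hi))
    simp only [mul_sub] at h2
    rw [integral_sub hsin (integrableOn_sin_mul (IntegrableOn.shift_Ioi hpi.le hi))] at h2
    simp only [neg_mul, integral_neg] at h1
    have h3 : β (Real.pi / 2) ≤ ∫ t in Ioc 0 Real.pi, Real.sin t * β t := by
      calc β (Real.pi / 2) = ∫ t in Ioc 0 (Real.pi / 2), Real.sin t * β (Real.pi / 2) := by
            rw [integral_mul_const, ← intervalIntegral.integral_of_le (by positivity), integral_sin]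
            simp
        _ ≤ ∫ t in Ioc 0 (Real.pi / 2), Real.sin t * β t := by
            refine setIntegral_mono_on ?_ (hsin.mono_set Ioc_subset_Ioi_self) measurableSet_Ioc ?_
            · exact (Continuous.integrableOn_Ioc (by fun_prop))
            · intro t ht
              refine mul_le_mul_of_nonneg_left (ha ht.1 (by simp; positivity) ht.2) ?_
              exact Real.sin_nonneg_of_nonneg_of_le_pi ht.1.le (by linarith [ht.2])
        _ ≤ _ := by
            refine setIntegral_mono_set (hsin.mono_set Ioc_subset_Ioi_self) ?_
              (Ioc_subset_Ioc_right (by linarith)).eventuallyLE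
            refine (ae_restrict_iff' measurableSet_Ioc).2 (.of_forall fun t ht => ?_)
            exact mul_nonneg (Real.sin_nonneg_of_nonneg_of_le_pi ht.1.le ht.2) (hn t ht.1)
    linarith
  have hco : (∫ t in Ioc 0 (Real.pi / 2), Real.cos t * β t) - 2 * β (Real.pi / 2) ≤
      ∫ t in Ioi 0, Real.cos t * β t := by
    have hp2 : 0 ≤ Real.pi / 2 := by positivity
    have h1 := setIntegral_Ioi_split hp2 hcos
    simp only [Real.cos_add_pi_div_two, neg_mul, integral_neg] at h1
    have hi2 := IntegrableOn.shift_Ioi hp2 hi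
    have h2 := setIntegral_Ioi_split hpi.le (integrableOn_sin_mul hi2)
    simp only [Real.sin_add_pi, neg_mul, integral_neg] at h2
    have h3 := integral_sin_mul_nonneg (γ := fun t => β (t + Real.pi + Real.pi / 2))
      (fun s hs t ht hst => ha (by simp at *; linarith) (by simp at *; linarith) (by linarith))
      (IntegrableOn.shift_Ioi hpi.le hi2)
    have h4 : ∫ t in Ioc 0 Real.pi, Real.sin t * β (t + Real.pi / 2) ≤ 2 * β (Real.pi / 2) := by
      calc _ ≤ ∫ t in Ioc 0 Real.pi, Real.sin t * β (Real.pi / 2) := by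
            refine setIntegral_mono_on ((integrableOn_sin_mul hi2).mono_set Ioc_subset_Ioi_self)
              (Continuous.integrableOn_Ioc (by fun_prop)) measurableSet_Ioc ?_
            intro t ht
            refine mul_le_mul_of_nonneg_left (ha (by simp; positivity)
              (by have := ht.1; simp; linarith) (by linarith [ht.1])) ?_
            exact Real.sin_nonneg_of_nonneg_of_le_pi ht.1.le ht.2
        _ = _ := by
            rw [integral_mul_const, ← intervalIntegral.integral_of_le (by positivity), integral_sin]
            norm_num
    linarith
  have h1 : (1 / 2) * ∫ t in Ioc 0 1, β t ≤ ∫ t in Ioc 0 (Real.pi / 2), Real.cos t * β t := by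
    calc (1 / 2) * ∫ t in Ioc 0 1, β t = ∫ t in Ioc 0 1, (1 / 2) * β t := by
          rw [integral_const_mul]
      _ ≤ ∫ t in Ioc 0 1, Real.cos t * β t := by
          refine setIntegral_mono_on ((hi.mono_set Ioc_subset_Ioi_self).const_mul _)
            (hcos.mono_set Ioc_subset_Ioi_self) measurableSet_Ioc ?_
          intro t ht
          refine mul_le_mul_of_nonneg_right ?_ (hn t ht.1)
          rw [← Real.cos_pi_div_three]
          exact Real.cos_le_cos_of_nonneg_of_le_pi ht.1.le (by linarith) (by linarith [ht.2])
      _ ≤ _ := by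
          refine setIntegral_mono_set (hcos.mono_set Ioc_subset_Ioi_self) ?_
            (Ioc_subset_Ioc_right (by linarith)).eventuallyLE
          refine (ae_restrict_iff' measurableSet_Ioc).2 (.of_forall fun t ht => ?_)
          exact mul_nonneg (Real.cos_nonneg_of_neg_pi_div_two_le_of_le (by linarith [ht.1]) ht.2)
            (hn t ht.1)
  linarith

theorem norm_exp_neg_mul_ofReal (z : ℂ) (t : ℝ) :
    ‖Complex.exp (-z * t)‖ = Real.exp (-z.re * t) := by
  rw [Complex.norm_exp]; simp

/-- A function with nonnegative real part on the right half plane, real at `1` and `r ≥ 1`,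
decays at most like `1 / r`: a two-point Harnack inequality. -/
theorem le_mul_of_re_nonneg {f : ℂ → ℂ} (hd : ∀ z : ℂ, 0 < z.re → DifferentiableAt ℂ f z)
    (hre : ∀ z : ℂ, 0 < z.re → 0 ≤ (f z).re) {r g₁ g₂ : ℝ} (hr : 1 ≤ r) (hg₁ : 0 < g₁)
    (hg₂ : 0 < g₂) (h₁ : f 1 = g₁) (h₂ : f r = g₂) : g₁ ≤ r * g₂ := by
  have hφ : ∀ w ∈ Metric.ball (0 : ℂ) 1, 1 - w ≠ 0 ∧ 0 < ((1 + w) / (1 - w)).re := by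
    intro w hw
    have hw' : ‖w‖ < 1 := by simpa using hw
    have hne : 1 - w ≠ 0 := by
      intro h
      have : w = 1 := by linear_combination -h
      rw [this] at hw'; simp at hw'
    refine ⟨hne, ?_⟩
    rw [Complex.div_re, ← add_div]
    refine div_pos ?_ (Complex.normSq_pos.2 hne)
    have h3 : Complex.normSq w < 1 := by
      rw [Complex.normSq_eq_norm_sq]; nlinarith [norm_nonneg w]
    rw [Complex.normSq_apply] at h3
    simp only [Complex.add_re, Complex.one_re, Complex.sub_re, Complex.add_im, Complex.one_im,
      Complex.sub_im]
    nlinarith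
  have hne : ∀ w ∈ Metric.ball (0 : ℂ) 1, f ((1 + w) / (1 - w)) + g₁ ≠ 0 := by
    intro w hw h
    have h4 := congrArg Complex.re h
    have h5 := hre _ (hφ w hw).2
    simp only [Complex.add_re, Complex.ofReal_re, Complex.zero_re] at h4
    linarith
  have hS := Complex.norm_le_norm_of_mapsTo_ball
    (f := fun w => (f ((1 + w) / (1 - w)) - g₁) / (f ((1 + w) / (1 - w)) + g₁)) (R := 1)
    (z := ((r - 1) / (r + 1) : ℝ)) ?_ ?_ ?_ ?_
  · have hr1 : (1 + (((r - 1) / (r + 1) : ℝ) : ℂ)) / (1 - (((r - 1) / (r + 1) : ℝ) : ℂ)) = r := by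
      have h6 : (r : ℂ) + 1 ≠ 0 := by
        exact_mod_cast (by linarith : r + 1 ≠ 0)
      push_cast
      have h7 : (1 - ((r : ℂ) - 1) / (r + 1)) = 2 / (r + 1) := by field_simp; ring
      rw [h7]; field_simp; ring
    simp only [hr1, h₂] at hS
    rw [← Complex.ofReal_sub, ← Complex.ofReal_add, ← Complex.ofReal_div, Complex.norm_real,
      Complex.norm_real, Real.norm_eq_abs, Real.norm_eq_abs,
      abs_of_nonneg (div_nonneg (by linarith) (by linarith : (0 : ℝ) ≤ r + 1)), abs_div,
      abs_of_pos (by linarith : 0 < g₂ + g₁), div_le_div_iff₀ (by linarith) (by linarith)] at hS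
    have := neg_abs_le (g₂ - g₁)
    nlinarith
  · intro w hw
    refine DifferentiableAt.differentiableWithinAt ?_
    have h8 : DifferentiableAt ℂ (fun w : ℂ => f ((1 + w) / (1 - w))) w := by
      refine DifferentiableAt.comp w (hd _ (hφ w hw).2) ?_
      exact DifferentiableAt.div (by fun_prop) (by fun_prop) (hφ w hw).1
    exact (h8.sub_const _).div (h8.add_const _) (hne w hw)
  · intro w hw
    rw [mem_closedBall_zero_iff, norm_div, div_le_one (norm_pos_iff.2 (hne w hw))]
    have h9 := hre _ (hφ w hw).2
    rw [← sq_le_sq₀ (norm_nonneg _) (norm_nonneg _), ← Complex.normSq_eq_norm_sq,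
      ← Complex.normSq_eq_norm_sq, Complex.normSq_apply, Complex.normSq_apply]
    simp
    nlinarith
  · simp [h₁]
  · rw [Complex.norm_real, Real.norm_eq_abs,
      abs_of_nonneg (div_nonneg (by linarith) (by linarith : (0 : ℝ) ≤ r + 1)),
      div_lt_one (by linarith)]
    linarith

namespace Assumption1

variable {b b' : ℝ → ℝ} {ρ : ℝ}

theorem aestronglyMeasurable (hb : Assumption1 b b' ρ) :
    AEStronglyMeasurable b (volume.restrict (Ioi 0)) :=
  (aemeasurable_restrict_of_antitoneOn measurableSet_Ioi hb.anti).aestronglyMeasurable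

theorem integrableOn_exp_mul (hb : Assumption1 b b' ρ) {ε : ℝ} (hε : 0 < ε) :
    IntegrableOn (fun t => Real.exp (-ε * t) * b t) (Ioi 0) := by
  rw [← Ioc_union_Ioi_eq_Ioi zero_le_one]
  refine IntegrableOn.union ?_ ?_
  · refine Integrable.bdd_mul (c := 1) (hb.locInt 1 one_pos) (by fun_prop) ?_
    refine (ae_restrict_iff' measurableSet_Ioc).2 (.of_forall fun t ht => ?_)
    rw [Real.norm_eq_abs, Real.abs_exp, Real.exp_le_one_iff]
    nlinarith [ht.1]
  · refine Integrable.mul_bdd (c := b 1) (integrableOn_exp_mul_Ioi (by linarith) 1)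
      (hb.aestronglyMeasurable.mono_measure (Measure.restrict_mono_set _
        (Ioi_subset_Ioi zero_le_one))) ?_
    refine (ae_restrict_iff' measurableSet_Ioi).2 (.of_forall fun t ht => ?_)
    have ht : 1 < t := ht
    rw [Real.norm_eq_abs, abs_of_nonneg (hb.nonneg t (by linarith))]
    exact hb.anti (by simp) (by simp; linarith) ht.le

theorem integrableOn_cexp_mul (hb : Assumption1 b b' ρ) {z : ℂ} (hz : 0 < z.re) :
    IntegrableOn (fun t : ℝ => Complex.exp (-z * t) * (b t : ℂ)) (Ioi 0) := by
  refine (hb.integrableOn_exp_mul hz).mono' ?_ ?_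
  · exact (Continuous.aestronglyMeasurable (by fun_prop)).mul
      (Complex.continuous_ofReal.comp_aestronglyMeasurable hb.aestronglyMeasurable)
  · refine (ae_restrict_iff' measurableSet_Ioi).2 (.of_forall fun t ht => ?_)
    rw [norm_mul, norm_exp_neg_mul_ofReal, Complex.norm_real, Real.norm_eq_abs,
      abs_of_nonneg (hb.nonneg t ht)]

theorem differentiableAt_laplaceTransform (hb : Assumption1 b b' ρ) {z : ℂ} (hz : 0 < z.re) :
    DifferentiableAt ℂ (laplaceTransform b) z := by
  have hδ : 0 < z.re / 2 := by linarith
  refine (hasDerivAt_integral_of_dominated_loc_of_deriv_le (μ := volume.restrict (Ioi 0))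
    (F := fun z (t : ℝ) => Complex.exp (-z * t) * (b t : ℂ))
    (F' := fun z (t : ℝ) => Complex.exp (-z * t) * (-t) * (b t : ℂ))
    (bound := fun t => (4 / z.re) * (Real.exp (-(z.re / 4) * t) * b t))
    (s := Metric.ball z (z.re / 2)) (Metric.ball_mem_nhds z hδ) ?_ ?_ ?_ ?_ ?_ ?_).2.differentiableAt
  · exact .of_forall fun w => (Continuous.aestronglyMeasurable (by fun_prop)).mul
      (Complex.continuous_ofReal.comp_aestronglyMeasurable hb.aestronglyMeasurable)
  · exact hb.integrableOn_cexp_mul hz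
  · exact (Continuous.aestronglyMeasurable (by fun_prop)).mul
      (Complex.continuous_ofReal.comp_aestronglyMeasurable hb.aestronglyMeasurable)
  · refine (ae_restrict_iff' measurableSet_Ioi).2 (.of_forall fun t ht w hw => ?_)
    have ht : 0 < t := ht
    have hw : z.re / 2 < w.re := by
      have h1 := (Complex.abs_re_le_norm (w - z)).trans_lt (by simpa [dist_eq_norm] using hw)
      rw [Complex.sub_re, abs_lt] at h1
      linarith
    rw [norm_mul, norm_mul, norm_exp_neg_mul_ofReal, norm_neg, Complex.norm_real, Complex.norm_real,
      Real.norm_eq_abs, Real.norm_eq_abs, abs_of_pos ht, abs_of_nonneg (hb.nonneg t ht), ← mul_assoc]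
    refine mul_le_mul_of_nonneg_right ?_ (hb.nonneg t ht)
    have h2 : Real.exp (-w.re * t) ≤ Real.exp (-(z.re / 4) * t) * Real.exp (-(z.re / 4 * t)) := by
      rw [← Real.exp_add]; exact Real.exp_le_exp.2 (by nlinarith)
    have h3 : (z.re / 4 * t) * Real.exp (-(z.re / 4 * t)) ≤ 1 := by
      rw [Real.exp_neg, ← div_eq_mul_inv, div_le_one (Real.exp_pos _)]
      linarith [Real.add_one_le_exp (z.re / 4 * t)]
    calc Real.exp (-w.re * t) * t
        ≤ Real.exp (-(z.re / 4) * t) * Real.exp (-(z.re / 4 * t)) * t := by gcongr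
      _ = (4 / z.re) * Real.exp (-(z.re / 4) * t) *
            ((z.re / 4 * t) * Real.exp (-(z.re / 4 * t))) := by field_simp
      _ ≤ (4 / z.re) * Real.exp (-(z.re / 4) * t) * 1 := by gcongr
      _ = _ := mul_one _
  · exact (hb.integrableOn_exp_mul (by linarith)).const_mul _
  · refine .of_forall fun t w _ => ?_
    have h1 : HasDerivAt (fun w : ℂ => -w * (t : ℂ)) (-(t : ℂ)) w := by
      simpa using ((hasDerivAt_id w).neg).mul_const (t : ℂ)
    exact h1.cexp.mul_const _

theorem abs_arg_le (hb : Assumption1 b b' ρ) {z : ℂ} (hz : 0 < z.re) :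
    |(laplaceTransform b z).arg| ≤ (ρ - 1) * (Real.pi / 2) := by
  have h1 : |(laplaceTransform b z).arg| ≤
      sSup {θ : ℝ | ∃ z : ℂ, 0 < z.re ∧ θ = |(laplaceTransform b z).arg|} := by
    refine le_csSup ⟨Real.pi, ?_⟩ ⟨z, hz, rfl⟩
    rintro _ ⟨w, _, rfl⟩
    exact Complex.abs_arg_le_pi _
  have h2 := hb.rho_eq
  have hpi := Real.pi_pos
  rw [h2]
  field_simp
  linarith

theorem sin_lt_one (hb : Assumption1 b b' ρ) : Real.sin ((ρ - 1) * (Real.pi / 2)) < 1 := by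
  have h := hb.rho_mem
  have hpi := Real.pi_pos
  refine lt_of_lt_of_eq ?_ Real.sin_pi_div_two
  exact Real.sin_lt_sin_of_lt_of_le_pi_div_two (by nlinarith [h.1]) le_rfl (by nlinarith [h.2])

theorem abs_im_le (hb : Assumption1 b b' ρ) {z : ℂ} (hz : 0 < z.re) :
    |(laplaceTransform b z).im| ≤
      Real.sin ((ρ - 1) * (Real.pi / 2)) * ‖laplaceTransform b z‖ := by
  have h := hb.abs_arg_le hz
  have hr := hb.rho_mem
  have hpi := Real.pi_pos
  rw [← Complex.norm_mul_sin_arg, abs_mul, abs_norm, mul_comm]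
  refine mul_le_mul_of_nonneg_right ?_ (norm_nonneg _)
  rw [Real.abs_sin_eq_sin_abs_of_abs_le_pi (Complex.abs_arg_le_pi _)]
  exact Real.sin_le_sin_of_le_of_le_pi_div_two (by linarith [abs_nonneg (laplaceTransform b z).arg])
    (by nlinarith [hr.2]) h

theorem re_nonneg (hb : Assumption1 b b' ρ) {z : ℂ} (hz : 0 < z.re) :
    0 ≤ (laplaceTransform b z).re := by
  have h := hb.abs_arg_le hz
  rw [← Complex.abs_arg_le_pi_div_two_iff]
  nlinarith [hb.rho_mem.2, Real.pi_pos]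

end Assumption1

/-- Rescaled version of `integral_cos_add_sin_ge`. -/
theorem integral_cos_mul_add_sin_mul_ge {g : ℝ → ℝ} (hn : ∀ t > 0, 0 ≤ g t)
    (ha : AntitoneOn g (Ioi 0)) (hc : ConvexOn ℝ (Ioi 0) g) (hi : IntegrableOn g (Ioi 0))
    {ω : ℝ} (hω : 0 < ω) :
    (1 / 2) * ∫ t in Ioc 0 ω⁻¹, g t ≤
      (∫ t in Ioi 0, Real.cos (ω * t) * g t) + 4 * ∫ t in Ioi 0, Real.sin (ω * t) * g t := by
  have hω' : 0 < ω⁻¹ := inv_pos.2 hω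
  have key := integral_cos_add_sin_ge (β := fun u => g (ω⁻¹ * u))
    (fun t ht => hn _ (mul_pos hω' ht))
    (fun s hs t ht hst => ha (mul_pos hω' hs) (mul_pos hω' ht) (by gcongr)) ?_
    ((integrableOn_Ioi_comp_mul_left_iff g 0 hω').2 (by simpa using hi))
  · have e1 : ∀ F : ℝ → ℝ, ∫ t in Ioi 0, F (ω * t) * g t =
        ω⁻¹ * ∫ u in Ioi 0, F u * g (ω⁻¹ * u) := by
      intro F
      have := integral_comp_mul_left_Ioi (fun u => F u * g (ω⁻¹ * u)) 0 hω
      rw [mul_zero, smul_eq_mul] at this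
      rw [← this]
      refine setIntegral_congr_fun measurableSet_Ioi fun t _ => ?_
      rw [inv_mul_cancel_left₀ hω.ne']
    have e2 : ∫ t in Ioc 0 ω⁻¹, g t = ω⁻¹ * ∫ u in Ioc 0 1, g (ω⁻¹ * u) := by
      rw [← intervalIntegral.integral_of_le hω'.le, ← intervalIntegral.integral_of_le zero_le_one,
        intervalIntegral.integral_comp_mul_left _ hω'.ne', smul_eq_mul, mul_zero, mul_one, inv_inv,
        inv_mul_cancel_left₀ hω.ne']
    rw [e1, e1, e2]
    nlinarith
  · refine ⟨convex_Ioi 0, fun s hs t ht p q hp hq hpq => ?_⟩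
    have := hc.2 (mul_pos hω' hs : 0 < ω⁻¹ * s) (mul_pos hω' ht : 0 < ω⁻¹ * t) hp hq hpq
    simp only [smul_eq_mul] at this ⊢
    convert this using 2
    ring

theorem laplaceTransform_re {f : ℝ → ℝ} {ε : ℝ} (ω : ℝ)
    (h : IntegrableOn (fun t : ℝ => Complex.exp (-(ε + ω * Complex.I) * t) * (f t : ℂ)) (Ioi 0)) :
    (laplaceTransform f (ε + ω * Complex.I)).re =
      ∫ t in Ioi 0, Real.cos (ω * t) * (Real.exp (-ε * t) * f t) := by
  rw [laplaceTransform, ← Complex.reCLM_apply, ← Complex.reCLM.integral_comp_comm h]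
  refine setIntegral_congr_fun measurableSet_Ioi fun t _ => ?_
  simp [Complex.exp_re, Real.cos_neg]
  ring

theorem laplaceTransform_im {f : ℝ → ℝ} {ε : ℝ} (ω : ℝ)
    (h : IntegrableOn (fun t : ℝ => Complex.exp (-(ε + ω * Complex.I) * t) * (f t : ℂ)) (Ioi 0)) :
    (laplaceTransform f (ε + ω * Complex.I)).im =
      -∫ t in Ioi 0, Real.sin (ω * t) * (Real.exp (-ε * t) * f t) := by
  rw [laplaceTransform, ← Complex.imCLM_apply, ← Complex.imCLM.integral_comp_comm h,
    ← integral_neg]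
  refine setIntegral_congr_fun measurableSet_Ioi fun t _ => ?_
  simp [Complex.exp_im]
  ring

namespace Assumption1

variable {b b' : ℝ → ℝ} {ρ : ℝ}

theorem antitoneOn_exp_mul (hb : Assumption1 b b' ρ) {ε : ℝ} (hε : 0 < ε) :
    AntitoneOn (fun t => Real.exp (-ε * t) * b t) (Ioi 0) := fun s hs t ht hst =>
  mul_le_mul (Real.exp_le_exp.2 (by nlinarith)) (hb.anti hs ht hst) (hb.nonneg t ht)
    (Real.exp_pos _).le

theorem convexOn_exp_mul (hb : Assumption1 b b' ρ) {ε : ℝ} (hε : 0 < ε) :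
    ConvexOn ℝ (Ioi 0) (fun t => Real.exp (-ε * t) * b t) := by
  have h1 : ConvexOn ℝ (Ioi 0) (fun t => Real.exp (-ε * t)) := by
    refine ⟨convex_Ioi 0, fun s _ t _ p q hp hq hpq => ?_⟩
    have := convexOn_exp.2 (mem_univ (-ε * s)) (mem_univ (-ε * t)) hp hq hpq
    simp only [smul_eq_mul] at this ⊢
    convert this using 2
    ring
  refine h1.mul hb.cvx (fun s _ => (Real.exp_pos _).le) (fun t ht => hb.nonneg t ht) ?_
  refine AntitoneOn.monovaryOn (fun s _ t _ hst => Real.exp_le_exp.2 (by nlinarith)) hb.anti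

theorem le_norm_laplaceTransform_of_pos (hb : Assumption1 b b' ρ) {ε ω a : ℝ} (hε : 0 < ε)
    (hω : 0 < ω) (ha : a * ω ≤ 1) :
    (1 / 10) * ∫ t in Ioc 0 a, Real.exp (-ε * t) * b t ≤
      ‖laplaceTransform b (ε + ω * Complex.I)‖ := by
  have hz : 0 < ((ε : ℂ) + ω * Complex.I).re := by simpa using hε
  have h1 := integral_cos_mul_add_sin_mul_ge (g := fun t => Real.exp (-ε * t) * b t)
    (fun t ht => mul_nonneg (Real.exp_pos _).le (hb.nonneg t ht)) (hb.antitoneOn_exp_mul hε)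
    (hb.convexOn_exp_mul hε) (hb.integrableOn_exp_mul hε) hω
  rw [← laplaceTransform_re ω (hb.integrableOn_cexp_mul hz),
    ← neg_neg (∫ t in Ioi 0, Real.sin (ω * t) * (Real.exp (-ε * t) * b t)),
    ← laplaceTransform_im ω (hb.integrableOn_cexp_mul hz)] at h1
  have h2 : ∫ t in Ioc 0 a, Real.exp (-ε * t) * b t ≤
      ∫ t in Ioc 0 ω⁻¹, Real.exp (-ε * t) * b t := by
    refine setIntegral_mono_set
      ((hb.integrableOn_exp_mul hε).mono_set Ioc_subset_Ioi_self) ?_ ?_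
    · exact (ae_restrict_iff' measurableSet_Ioc).2 (.of_forall fun t ht =>
        mul_nonneg (Real.exp_pos _).le (hb.nonneg t ht.1))
    · exact (Ioc_subset_Ioc_right (by rwa [← one_div, le_div_iff₀ hω])).eventuallyLE
  have h3 := Complex.abs_re_le_norm (laplaceTransform b (ε + ω * Complex.I))
  have h4 := Complex.abs_im_le_norm (laplaceTransform b (ε + ω * Complex.I))
  linarith [abs_le.1 h3, (abs_le.1 h4).1]

theorem _root_.laplaceTransform_conj (f : ℝ → ℝ) (z : ℂ) :
    laplaceTransform f (starRingEnd ℂ z) = starRingEnd ℂ (laplaceTransform f z) := by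
  rw [laplaceTransform, laplaceTransform, ← integral_conj]
  refine setIntegral_congr_fun measurableSet_Ioi fun t _ => ?_
  simp [← Complex.exp_conj]

/-- The modulus of `b̂` on a vertical line controls the mass of `b` near the origin. -/
theorem le_norm_laplaceTransform (hb : Assumption1 b b' ρ) {ε ω a : ℝ} (hε : 0 < ε)
    (ha : a * |ω| ≤ 1) :
    (1 / 10) * ∫ t in Ioc 0 a, Real.exp (-ε * t) * b t ≤
      ‖laplaceTransform b (ε + ω * Complex.I)‖ := by
  rcases lt_trichotomy ω 0 with hω | hω | hω
  · have h := hb.le_norm_laplaceTransform_of_pos (ω := -ω) hε (by linarith)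
      (by rwa [abs_of_neg hω] at ha)
    have h2 : ((ε : ℂ) + (-ω : ℝ) * Complex.I) = starRingEnd ℂ (ε + ω * Complex.I) := by simp
    rwa [h2, laplaceTransform_conj, RCLike.norm_conj] at h
  · have hz : 0 < ((ε : ℂ) + ω * Complex.I).re := by simpa using hε
    have h1 := laplaceTransform_re ω (hb.integrableOn_cexp_mul hz)
    have hnn : ∀ t > 0, 0 ≤ Real.exp (-ε * t) * b t := fun t ht =>
      mul_nonneg (Real.exp_pos _).le (hb.nonneg t ht)
    have h2 : ∫ t in Ioc 0 a, Real.exp (-ε * t) * b t ≤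
        ∫ t in Ioi 0, Real.exp (-ε * t) * b t :=
      setIntegral_mono_set (hb.integrableOn_exp_mul hε)
        ((ae_restrict_iff' measurableSet_Ioi).2 (.of_forall fun t ht => hnn t ht))
        Ioc_subset_Ioi_self.eventuallyLE
    have h0 : 0 ≤ ∫ t in Ioc 0 a, Real.exp (-ε * t) * b t :=
      setIntegral_nonneg measurableSet_Ioc fun t ht => hnn t ht.1
    have h3 := Complex.re_le_norm (laplaceTransform b (ε + ω * Complex.I))
    rw [h1] at h3
    simp only [hω, zero_mul, Real.cos_zero, one_mul] at h3 ⊢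
    linarith
  · exact hb.le_norm_laplaceTransform_of_pos hε hω (by rwa [abs_of_pos hω] at ha)

theorem setIntegral_exp_mul_pos (hb : Assumption1 b b' ρ) {ε a : ℝ} (hε : 0 < ε) (ha : 0 < a) :
    0 < ∫ t in Ioc 0 a, Real.exp (-ε * t) * b t := by
  obtain ⟨t₀, ht₀, hbt⟩ := hb.ne_zero
  have hpos : 0 < b t₀ := lt_of_le_of_ne (hb.nonneg _ ht₀) hbt.symm
  have hc : 0 < Real.exp (-ε * min a t₀) * b t₀ := mul_pos (Real.exp_pos _) hpos
  have hm : 0 < min a t₀ := lt_min ha ht₀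
  have hint : IntegrableOn (fun t => Real.exp (-ε * t) * b t) (Ioc 0 a) :=
    (hb.integrableOn_exp_mul hε).mono_set Ioc_subset_Ioi_self
  calc 0 < ∫ _ in Ioc 0 (min a t₀), Real.exp (-ε * min a t₀) * b t₀ := by
        rw [setIntegral_const]; simp [hm.le, hm, hpos, Real.exp_pos]
    _ ≤ ∫ t in Ioc 0 (min a t₀), Real.exp (-ε * t) * b t := by
        refine setIntegral_mono_on (integrableOn_const (by simp)) (hint.mono_set
          (Ioc_subset_Ioc_right (min_le_left _ _))) measurableSet_Ioc fun t ht => ?_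
        refine mul_le_mul (Real.exp_le_exp.2 (by nlinarith [ht.2])) ?_ hpos.le (Real.exp_pos _).le
        exact hb.anti ht.1 ht₀ (ht.2.trans (min_le_right _ _))
    _ ≤ _ := setIntegral_mono_set hint
        ((ae_restrict_iff' measurableSet_Ioc).2 (.of_forall fun t ht =>
          mul_nonneg (Real.exp_pos _).le (hb.nonneg t ht.1)))
        (Ioc_subset_Ioc_right (min_le_left _ _)).eventuallyLE

theorem laplaceTransform_ne_zero (hb : Assumption1 b b' ρ) {z : ℂ} (hz : 0 < z.re) :
    laplaceTransform b z ≠ 0 := by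
  have h := hb.le_norm_laplaceTransform (ω := z.im) (a := (|z.im| + 1)⁻¹) hz (by
    rw [inv_mul_le_one₀ (by positivity)]; linarith)
  rw [Complex.re_add_im] at h
  have := hb.setIntegral_exp_mul_pos (a := (|z.im| + 1)⁻¹) hz (by positivity)
  exact norm_pos_iff.1 (by linarith)

theorem re_pos (hb : Assumption1 b b' ρ) {z : ℂ} (hz : 0 < z.re) :
    0 < (laplaceTransform b z).re := by
  refine lt_of_le_of_ne (hb.re_nonneg hz) fun h => ?_
  have h1 := hb.abs_im_le hz
  have h2 := Complex.norm_eq_sqrt_sq_add_sq (laplaceTransform b z)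
  rw [← h, zero_pow two_ne_zero, zero_add, Real.sqrt_sq_eq_abs] at h2
  have h3 := norm_pos_iff.2 (hb.laplaceTransform_ne_zero hz)
  have h4 := hb.sin_lt_one
  nlinarith

end Assumption1

theorem laplaceTransform_ofReal (f : ℝ → ℝ) (r : ℝ) :
    laplaceTransform f r = ((∫ t in Ioi 0, Real.exp (-r * t) * f t : ℝ) : ℂ) := by
  rw [laplaceTransform, ← integral_complex_ofReal]
  refine setIntegral_congr_fun measurableSet_Ioi fun t _ => ?_
  simp

/-- The angle condition limits the decay of `b̂` along the positive axis. -/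
theorem Assumption1.rpow_le_integral {b b' : ℝ → ℝ} {ρ : ℝ} (hb : Assumption1 b b' ρ) {r : ℝ}
    (hr : 1 ≤ r) :
    (∫ t in Ioi 0, Real.exp (-1 * t) * b t) * r ^ (1 - ρ) ≤
      ∫ t in Ioi 0, Real.exp (-r * t) * b t := by
  have hρ := hb.rho_mem
  have hpi := Real.pi_pos
  have hr0 : 0 < r := by linarith
  have hposr : ∀ r > 0, 0 < ∫ t in Ioi 0, Real.exp (-r * t) * b t := by
    intro r hr
    have := hb.re_pos (z := r) (by simpa using hr)
    rwa [laplaceTransform_ofReal, Complex.ofReal_re] at this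
  have hq : 0 < 1 / (ρ - 1) := by
    have := hρ.1
    exact one_div_pos.2 (by linarith)
  have key := le_mul_of_re_nonneg
    (f := fun z => laplaceTransform b z ^ ((1 / (ρ - 1) : ℝ) : ℂ)) (r := r)
    (g₁ := (∫ t in Ioi 0, Real.exp (-1 * t) * b t) ^ (1 / (ρ - 1)))
    (g₂ := (∫ t in Ioi 0, Real.exp (-r * t) * b t) ^ (1 / (ρ - 1))) ?_ ?_ hr
    (Real.rpow_pos_of_pos (hposr 1 one_pos) _) (Real.rpow_pos_of_pos (hposr r hr0) _) ?_ ?_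
  · have h1 := Real.rpow_le_rpow (Real.rpow_pos_of_pos (hposr 1 one_pos) _).le key
      (by linarith [hρ.1] : 0 ≤ ρ - 1)
    have hne : ρ - 1 ≠ 0 := by linarith [hρ.1]
    rw [← Real.rpow_mul (hposr 1 one_pos).le,
      Real.mul_rpow hr0.le (Real.rpow_pos_of_pos (hposr r hr0) _).le,
      ← Real.rpow_mul (hposr r hr0).le, one_div_mul_cancel hne, Real.rpow_one, Real.rpow_one] at h1
    calc _ ≤ (r ^ (ρ - 1) * ∫ t in Ioi 0, Real.exp (-r * t) * b t) * r ^ (1 - ρ) := by gcongr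
      _ = (r ^ (ρ - 1) * r ^ (1 - ρ)) * ∫ t in Ioi 0, Real.exp (-r * t) * b t := by ring
      _ = _ := by rw [← Real.rpow_add hr0]; simp
  · intro z hz
    exact (hb.differentiableAt_laplaceTransform hz).cpow_const (.inl (hb.re_pos hz))
  · intro z hz
    rw [Complex.cpow_def_of_ne_zero (hb.laplaceTransform_ne_zero hz), Complex.exp_re]
    refine mul_nonneg (Real.exp_pos _).le (Real.cos_nonneg_of_mem_Icc ?_)
    have h2 : (Complex.log (laplaceTransform b z) * ((1 / (ρ - 1) : ℝ) : ℂ)).im =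
        (laplaceTransform b z).arg * (1 / (ρ - 1)) := by
      rw [Complex.im_mul_ofReal, Complex.log_im]
    have h3 := hb.abs_arg_le hz
    have h4 : |(laplaceTransform b z).arg * (1 / (ρ - 1))| ≤ Real.pi / 2 := by
      rw [abs_mul, abs_of_pos hq, mul_one_div, div_le_iff₀ (by linarith [hρ.1])]
      linarith
    rw [h2]
    exact ⟨by linarith [(abs_le.1 h4).1], (abs_le.1 h4).2⟩
  · rw [← Complex.ofReal_one, laplaceTransform_ofReal, ← Complex.ofReal_cpow (hposr 1 one_pos).le]
  · rw [laplaceTransform_ofReal, ← Complex.ofReal_cpow (hposr r hr0).le]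

/-- The mass near the origin controls the Laplace transform on the positive axis. -/
theorem Assumption1.integral_le_two_mul {b b' : ℝ → ℝ} {ρ : ℝ} (hb : Assumption1 b b' ρ) {r : ℝ}
    (hr : 0 < r) :
    ∫ t in Ioi 0, Real.exp (-r * t) * b t ≤ 2 * ∫ t in Ioc 0 r⁻¹, b t := by
  have hr' : 0 < r⁻¹ := inv_pos.2 hr
  have hI := hb.locInt _ hr'
  have hint := hb.integrableOn_exp_mul hr
  have hbr : r⁻¹ * b r⁻¹ ≤ ∫ t in Ioc 0 r⁻¹, b t := by
    calc r⁻¹ * b r⁻¹ = ∫ _ in Ioc 0 r⁻¹, b r⁻¹ := by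
          rw [setIntegral_const]; simp [hr.le]
      _ ≤ _ := setIntegral_mono_on (integrableOn_const (by simp)) hI measurableSet_Ioc
          fun t ht => hb.anti ht.1 hr' ht.2
  have h1 : ∫ t in Ioc 0 r⁻¹, Real.exp (-r * t) * b t ≤ ∫ t in Ioc 0 r⁻¹, b t := by
    refine setIntegral_mono_on (hint.mono_set Ioc_subset_Ioi_self) hI measurableSet_Ioc
      fun t ht => mul_le_of_le_one_left (hb.nonneg t ht.1) ?_
    rw [Real.exp_le_one_iff]
    nlinarith [ht.1]
  have h2 : ∫ t in Ioi r⁻¹, Real.exp (-r * t) * b t ≤ r⁻¹ * b r⁻¹ := by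
    calc _ ≤ ∫ t in Ioi r⁻¹, Real.exp (-r * t) * b r⁻¹ := by
          refine setIntegral_mono_on (hint.mono_set (Ioi_subset_Ioi hr'.le))
            ((integrableOn_exp_mul_Ioi (by linarith) _).mul_const _) measurableSet_Ioi fun t ht => ?_
          have ht : r⁻¹ < t := ht
          exact mul_le_mul_of_nonneg_left (hb.anti hr' (hr'.trans ht) ht.le) (Real.exp_pos _).le
      _ = (r⁻¹ * Real.exp (-1)) * b r⁻¹ := by
          rw [integral_mul_const, integral_exp_mul_Ioi (by linarith)]
          field_simp
      _ ≤ (r⁻¹ * 1) * b r⁻¹ := by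
          have := hb.nonneg _ hr'
          gcongr
          simp
      _ = _ := by rw [mul_one]
  rw [← Ioc_union_Ioi_eq_Ioi hr'.le, setIntegral_union (Set.Ioc_disjoint_Ioi le_rfl)
    measurableSet_Ioi (hint.mono_set Ioc_subset_Ioi_self)
    (hint.mono_set (Ioi_subset_Ioi hr'.le))]
  linarith

/-- The lower bound `|b̂(ε + iω)| ≥ c (1 + |ω|)^{1-ρ}` near the imaginary axis. -/
theorem Assumption1.exists_le_norm_laplaceTransform {b b' : ℝ → ℝ} {ρ : ℝ}
    (hb : Assumption1 b b' ρ) :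
    ∃ c > 0, ∀ ε : ℝ, 0 < ε → ε ≤ 1 → ∀ ω : ℝ,
      c * (1 + |ω|) ^ (1 - ρ) ≤ ‖laplaceTransform b (ε + ω * Complex.I)‖ := by
  have hB : 0 < ∫ t in Ioi 0, Real.exp (-1 * t) * b t := by
    have := hb.re_pos (z := (1 : ℝ)) (by simp)
    rwa [laplaceTransform_ofReal, Complex.ofReal_re] at this
  set B := ∫ t in Ioi 0, Real.exp (-1 * t) * b t with hBdef
  refine ⟨1 / 20 * Real.exp (-1) * B, by positivity, fun ε hε hε1 ω => ?_⟩
  have hr : 1 ≤ 1 + |ω| := by linarith [abs_nonneg ω]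
  have hr0 : 0 < 1 + |ω| := by linarith
  have h1 := hb.rpow_le_integral hr
  have h2 := hb.integral_le_two_mul hr0
  have h3 := hb.le_norm_laplaceTransform (ε := ε) (ω := ω) (a := (1 + |ω|)⁻¹) hε (by
    rw [inv_mul_le_one₀ hr0]; linarith)
  have hr1 : (1 + |ω|)⁻¹ ≤ 1 := inv_le_one_of_one_le₀ hr
  have h4 : Real.exp (-1) * ∫ t in Ioc 0 (1 + |ω|)⁻¹, b t ≤
      ∫ t in Ioc 0 (1 + |ω|)⁻¹, Real.exp (-ε * t) * b t := by
    rw [← integral_const_mul]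
    refine setIntegral_mono_on ((hb.locInt _ (inv_pos.2 hr0)).const_mul _)
      ((hb.integrableOn_exp_mul hε).mono_set Ioc_subset_Ioi_self) measurableSet_Ioc fun t ht => ?_
    refine mul_le_mul_of_nonneg_right (Real.exp_le_exp.2 ?_) (hb.nonneg t ht.1)
    nlinarith [ht.1, ht.2]
  have h5 := Real.exp_pos (-1)
  have h6 : Real.exp (-1) * (B * (1 + |ω|) ^ (1 - ρ)) ≤
      Real.exp (-1) * (2 * ∫ t in Ioc 0 (1 + |ω|)⁻¹, b t) :=
    mul_le_mul_of_nonneg_left (h1.trans h2) h5.le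
  linarith

/-- A quadratic form bound for complex numbers making an angle bounded away from `π`. -/
theorem one_sub_mul_le_norm_sq {z β : ℂ} {κ τ η : ℝ} (hκ : 0 ≤ κ) (hz : 0 ≤ z.re) (hβ : 0 ≤ β.re)
    (him : |β.im| ≤ κ * ‖β‖) (hτ : 0 ≤ τ) (hη : 0 ≤ η) :
    (1 - κ) * (‖z‖ ^ 2 * τ ^ 2 + ‖β‖ ^ 2 * η ^ 2) ≤ ‖z * τ + β * η‖ ^ 2 := by
  have h1 : -(κ * (‖z‖ * ‖β‖)) ≤ z.re * β.re + z.im * β.im := by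
    have h2 : |z.im * β.im| ≤ ‖z‖ * (κ * ‖β‖) := by
      rw [abs_mul]
      exact mul_le_mul (Complex.abs_im_le_norm z) him (abs_nonneg _) (norm_nonneg _)
    have := (abs_le.1 h2).1
    have := mul_nonneg hz hβ
    linarith
  have h3 : ‖z * τ + β * η‖ ^ 2 = ‖z‖ ^ 2 * τ ^ 2 + ‖β‖ ^ 2 * η ^ 2 +
      2 * (τ * η) * (z.re * β.re + z.im * β.im) := by
    simp only [← Complex.normSq_eq_norm_sq, Complex.normSq_apply]
    simp
    ring
  rw [h3]
  have h4 := mul_le_mul_of_nonneg_left h1 (mul_nonneg hτ hη)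
  have h5 := mul_nonneg hκ (sq_nonneg (‖z‖ * τ - ‖β‖ * η))
  nlinarith

theorem lintegral_inv_sq_add_sq {R : ℝ} (hR : 0 < R) :
    ∫⁻ ω : ℝ, ENNReal.ofReal (ω ^ 2 + R ^ 2)⁻¹ = ENNReal.ofReal (Real.pi * R⁻¹) := by
  have h1 : ∫⁻ ω : ℝ, ENNReal.ofReal (1 + ω ^ 2)⁻¹ = ENNReal.ofReal Real.pi := by
    rw [← integral_univ_inv_one_add_sq, ofReal_integral_eq_lintegral_ofReal
      integrable_inv_one_add_sq (.of_forall fun x => by positivity)]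
  have h2 := lintegral_comp_inv_mul hR
    (F := fun ω : ℝ => ENNReal.ofReal (1 + ω ^ 2)⁻¹) (by fun_prop)
  have h3 : ∀ ω : ℝ, ENNReal.ofReal (ω ^ 2 + R ^ 2)⁻¹ =
      ENNReal.ofReal ((R ^ 2)⁻¹) * ENNReal.ofReal (1 + (R⁻¹ * ω) ^ 2)⁻¹ := by
    intro ω
    rw [← ENNReal.ofReal_mul (by positivity)]
    congr 1
    field_simp
    ring
  simp_rw [h3]
  rw [lintegral_const_mul _ (by fun_prop), h2, h1, ← mul_assoc, ← ENNReal.ofReal_mul (by positivity),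
    ← ENNReal.ofReal_mul (by positivity)]
  congr 1
  field_simp

theorem Assumption1.exists_le_norm_add_mul {b b' : ℝ → ℝ} {ρ : ℝ} (hb : Assumption1 b b' ρ)
    {l₀ : ℝ} (hl₀ : 0 < l₀) :
    ∃ c > 0, ∀ l : ℝ, l₀ ≤ l → ∀ ε : ℝ, 0 < ε → ε ≤ 1 → ∀ ω : ℝ,
      c * (ω ^ 2 + (l ^ (1 / ρ)) ^ 2) ≤
        ‖(ε + ω * Complex.I) + l * laplaceTransform b (ε + ω * Complex.I)‖ ^ 2 := by
  obtain ⟨c₀, hc₀, H⟩ := hb.exists_le_norm_laplaceTransform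
  have hρ := hb.rho_mem
  have hρ0 : 0 < ρ := by linarith [hρ.1]
  have hκ1 := hb.sin_lt_one
  have hκ0 : 0 ≤ Real.sin ((ρ - 1) * (Real.pi / 2)) :=
    Real.sin_nonneg_of_nonneg_of_le_pi (by nlinarith [hρ.1, Real.pi_pos])
      (by nlinarith [hρ.2, Real.pi_pos])
  set κ := Real.sin ((ρ - 1) * (Real.pi / 2))
  have hR₀ : 0 < l₀ ^ (1 / ρ) := Real.rpow_pos_of_pos hl₀ _
  set K := 1 + (l₀ ^ (1 / ρ))⁻¹ with hK
  have hK0 : 0 < K := by positivity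
  have hKρ : 0 < K ^ (1 - ρ) := Real.rpow_pos_of_pos hK0 _
  refine ⟨(1 - κ) * min (1 / 2) (c₀ ^ 2 * (K ^ (1 - ρ)) ^ 2), mul_pos (by linarith)
    (lt_min (by norm_num) (by positivity)), fun l hl ε hε hε1 ω => ?_⟩
  have hl0 : 0 < l := hl₀.trans_le hl
  have hR : 0 < l ^ (1 / ρ) := Real.rpow_pos_of_pos hl0 _
  have hRR : l₀ ^ (1 / ρ) ≤ l ^ (1 / ρ) := Real.rpow_le_rpow hl₀.le hl (by positivity)
  set R := l ^ (1 / ρ) with hRdef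
  have hz : 0 < ((ε : ℂ) + ω * Complex.I).re := by simpa using hε
  have hω : |ω| ≤ ‖(ε : ℂ) + ω * Complex.I‖ := by
    simpa using Complex.abs_im_le_norm ((ε : ℂ) + ω * Complex.I)
  have h1 := one_sub_mul_le_norm_sq hκ0 hz.le (hb.re_nonneg hz) (hb.abs_im_le hz) zero_le_one hl0.le
  have h2 := H ε hε hε1 ω
  set β := laplaceTransform b (ε + ω * Complex.I)
  rw [Complex.ofReal_one, mul_one, mul_comm β] at h1
  refine le_trans ?_ h1
  rw [mul_assoc]
  refine mul_le_mul_of_nonneg_left ?_ (by linarith)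
  set m := min (1 / 2) (c₀ ^ 2 * (K ^ (1 - ρ)) ^ 2) with hm
  have hm1 : m ≤ 1 / 2 := min_le_left _ _
  have hm2 : m ≤ c₀ ^ 2 * (K ^ (1 - ρ)) ^ 2 := min_le_right _ _
  have hm0 : 0 ≤ m := le_min (by norm_num) (by positivity)
  have hω2 : ω ^ 2 ≤ ‖(ε : ℂ) + ω * Complex.I‖ ^ 2 := by
    rw [← sq_abs]; gcongr
  have hb2 : 0 ≤ ‖β‖ ^ 2 * l ^ 2 := by positivity
  rcases le_total R |ω| with hc | hc
  · have : R ^ 2 ≤ ω ^ 2 := by rw [← sq_abs ω]; gcongr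
    nlinarith
  · have h3 : K ^ (1 - ρ) * R ≤ l * (1 + |ω|) ^ (1 - ρ) := by
      have h4 : 1 + |ω| ≤ K * R := by
        have : 1 ≤ (l₀ ^ (1 / ρ))⁻¹ * R := by
          rwa [inv_mul_eq_div, one_le_div hR₀]
        rw [hK, add_mul]; linarith
      have h5 : (K * R) ^ (1 - ρ) ≤ (1 + |ω|) ^ (1 - ρ) :=
        Real.rpow_le_rpow_of_nonpos (by positivity) h4 (by linarith [hρ.1])
      have h6 : l = R ^ ρ := by
        rw [hRdef, ← Real.rpow_mul hl0.le, one_div_mul_cancel hρ0.ne', Real.rpow_one]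
      calc K ^ (1 - ρ) * R = l * (K * R) ^ (1 - ρ) := by
            rw [Real.mul_rpow hK0.le hR.le, h6, mul_left_comm, ← Real.rpow_add hR]
            simp
        _ ≤ _ := by gcongr
    have h7 : (c₀ * (K ^ (1 - ρ) * R)) ^ 2 ≤ (‖β‖ * l) ^ 2 := by
      refine pow_le_pow_left₀ (by positivity) ?_ 2
      calc c₀ * (K ^ (1 - ρ) * R) ≤ c₀ * (l * (1 + |ω|) ^ (1 - ρ)) := by gcongr
        _ = (c₀ * (1 + |ω|) ^ (1 - ρ)) * l := by ring
        _ ≤ _ := by gcongr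
    have h8 := mul_le_mul_of_nonneg_right hm2 (sq_nonneg R)
    have h9 := mul_le_mul_of_nonneg_right hm1 (sq_nonneg ω)
    have := sq_nonneg ω
    nlinarith

/-- The square integral of the scalar resolvent along vertical lines. -/
theorem Assumption1.exists_lintegral_inv_le {b b' : ℝ → ℝ} {ρ : ℝ} (hb : Assumption1 b b' ρ)
    {l₀ : ℝ} (hl₀ : 0 < l₀) :
    ∃ C > 0, ∀ l : ℝ, l₀ ≤ l → ∀ ε : ℝ, 0 < ε → ε ≤ 1 →
      ∫⁻ ω : ℝ, ‖((ε + ω * Complex.I) +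
        l * laplaceTransform b (ε + ω * Complex.I))⁻¹‖ₑ ^ 2 ≤
          ENNReal.ofReal (C * l ^ (-(1 / ρ))) := by
  obtain ⟨c, hc, H⟩ := hb.exists_le_norm_add_mul hl₀
  refine ⟨c⁻¹ * Real.pi, by positivity, fun l hl ε hε hε1 => ?_⟩
  have hR : 0 < l ^ (1 / ρ) := Real.rpow_pos_of_pos (hl₀.trans_le hl) _
  calc _ ≤ ∫⁻ ω : ℝ, ENNReal.ofReal c⁻¹ * ENNReal.ofReal (ω ^ 2 + (l ^ (1 / ρ)) ^ 2)⁻¹ := by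
        refine lintegral_mono fun ω => ?_
        rw [← ofReal_norm, ← ENNReal.ofReal_pow (norm_nonneg _), norm_inv, inv_pow,
          ← ENNReal.ofReal_mul (by positivity), ← mul_inv]
        exact ENNReal.ofReal_le_ofReal (inv_anti₀ (by positivity) (H l hl ε hε hε1 ω))
    _ = _ := by
        rw [lintegral_const_mul _ (by fun_prop), lintegral_inv_sq_add_sq hR,
          ← ENNReal.ofReal_mul (by positivity), Real.rpow_neg (hl₀.trans_le hl).le, mul_assoc]

/-- The causal convolution `t ↦ ∫₀ᵗ b(t-u) f(u) du`. -/
def causalConv (b f : ℝ → ℝ) (t : ℝ) : ℝ := ∫ u in (0 : ℝ)..t, b (t - u) * f u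

theorem exp_mul_causalConv (b f : ℝ → ℝ) (ε t : ℝ) :
    Real.exp (-ε * t) * causalConv b f t = ∫ u in (0 : ℝ)..t,
      (Real.exp (-ε * u) * f u) * (Real.exp (-ε * (t - u)) * b (t - u)) := by
  rw [causalConv, ← intervalIntegral.integral_const_mul]
  congr 1
  ext u
  have : Real.exp (-ε * t) = Real.exp (-ε * u) * Real.exp (-ε * (t - u)) := by
    rw [← Real.exp_add]; congr 1; ring
  rw [this]; ring

theorem integrableOn_exp_mul_causalConv {b f : ℝ → ℝ} {ε : ℝ}
    (hb : IntegrableOn (fun t => Real.exp (-ε * t) * b t) (Ioi 0))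
    (hf : IntegrableOn (fun t => Real.exp (-ε * t) * f t) (Ioi 0)) :
    IntegrableOn (fun t => Real.exp (-ε * t) * causalConv b f t) (Ioi 0) := by
  have h := (integrable_posConvolution hf hb (ContinuousLinearMap.mul ℝ ℝ)).integrableOn
    (s := Ioi (0 : ℝ))
  refine h.congr_fun (fun t ht => ?_) measurableSet_Ioi
  rw [posConvolution, indicator_of_mem ht, exp_mul_causalConv]
  rfl

theorem integrableOn_cexp_mul_of_integrableOn {f : ℝ → ℝ} {z : ℂ}
    (hf : IntegrableOn (fun t => Real.exp (-z.re * t) * f t) (Ioi 0)) :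
    IntegrableOn (fun t : ℝ => Complex.exp (-z * t) * (f t : ℂ)) (Ioi 0) := by
  have h : (fun t : ℝ => Complex.exp (-z * t) * (f t : ℂ)) = fun t : ℝ =>
      ((Real.exp (-z.re * t) * f t : ℝ) : ℂ) * Complex.exp (-(z.im * t : ℝ) * Complex.I) := by
    ext t
    rw [Complex.ofReal_mul, mul_right_comm, Complex.ofReal_exp, ← Complex.exp_add]
    congr 2
    conv_lhs => rw [← Complex.re_add_im z]
    push_cast
    ring
  rw [h]
  refine Integrable.mul_bdd (c := 1) hf.ofReal (by fun_prop) (.of_forall fun t => ?_)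
  rw [Complex.norm_exp]
  simp

theorem laplaceTransform_causalConv {b f : ℝ → ℝ} {z : ℂ}
    (hb : IntegrableOn (fun t => Real.exp (-z.re * t) * b t) (Ioi 0))
    (hf : IntegrableOn (fun t => Real.exp (-z.re * t) * f t) (Ioi 0)) :
    laplaceTransform (causalConv b f) z = laplaceTransform b z * laplaceTransform f z := by
  have h := integral_posConvolution (integrableOn_cexp_mul_of_integrableOn hf)
    (integrableOn_cexp_mul_of_integrableOn hb) (ContinuousLinearMap.mul ℝ ℂ)
  rw [ContinuousLinearMap.mul_apply', mul_comm] at h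
  rw [laplaceTransform, laplaceTransform, laplaceTransform, ← h]
  refine setIntegral_congr_fun measurableSet_Ioi fun t _ => ?_
  simp only [causalConv]
  rw [← intervalIntegral.integral_ofReal, ← intervalIntegral.integral_const_mul]
  congr 1
  ext u
  have : Complex.exp (-z * t) = Complex.exp (-z * u) * Complex.exp (-z * ((t - u : ℝ) : ℂ)) := by
    rw [← Complex.exp_add]; congr 1; push_cast; ring
  rw [this, ContinuousLinearMap.mul_apply']
  push_cast
  ring

theorem abs_exp_mul_causalConv_le {b f : ℝ → ℝ} {ε M : ℝ} (hε : 0 < ε) (hn : ∀ t > 0, 0 ≤ b t)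
    (hb : IntegrableOn (fun t => Real.exp (-ε * t) * b t) (Ioi 0))
    (hM : ∀ t > 0, |f t| ≤ M) {t : ℝ} (ht : 0 < t) :
    |Real.exp (-ε * t) * causalConv b f t| ≤ M * ∫ t in Ioi 0, Real.exp (-ε * t) * b t := by
  have hM0 : 0 ≤ M := (abs_nonneg _).trans (hM 1 one_pos)
  have hI : IntervalIntegrable (fun u => Real.exp (-ε * u) * b u) volume 0 t := by
    rw [intervalIntegrable_iff_integrableOn_Ioc_of_le ht.le]
    exact hb.mono_set Ioc_subset_Ioi_self
  have hI2 := (hI.comp_sub_left t).symm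
  rw [sub_zero, sub_self] at hI2
  rw [exp_mul_causalConv, ← Real.norm_eq_abs]
  calc _ ≤ ∫ u in (0 : ℝ)..t, M * (Real.exp (-ε * (t - u)) * b (t - u)) := by
        refine intervalIntegral.norm_integral_le_of_norm_le ht.le ?_ (hI2.const_mul M)
        filter_upwards [compl_mem_ae_iff.2 (measure_singleton t)] with u hu h
        have hu' : 0 < t - u := sub_pos.2 (lt_of_le_of_ne h.2 hu)
        have h0 := hn _ hu'
        rw [norm_mul, norm_mul, Real.norm_of_nonneg (mul_nonneg (Real.exp_pos _).le h0),
          Real.norm_eq_abs, Real.norm_eq_abs, Real.abs_exp]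
        refine mul_le_mul_of_nonneg_right ?_ (by positivity)
        refine (mul_le_of_le_one_left (abs_nonneg _) ?_).trans (hM u h.1)
        rw [Real.exp_le_one_iff]
        nlinarith [h.1]
    _ = M * ∫ u in (0 : ℝ)..t, Real.exp (-ε * u) * b u := by
        rw [intervalIntegral.integral_const_mul,
          intervalIntegral.integral_comp_sub_left (fun u => Real.exp (-ε * u) * b u)]
        simp
    _ ≤ _ := by
        refine mul_le_mul_of_nonneg_left ?_ hM0
        rw [intervalIntegral.integral_of_le ht.le]
        exact setIntegral_mono_set hb ((ae_restrict_iff' measurableSet_Ioi).2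
          (.of_forall fun t ht => mul_nonneg (Real.exp_pos _).le (hn t ht)))
          Ioc_subset_Ioi_self.eventuallyLE

theorem memLp_two_of_integrableOn_of_abs_le {g : ℝ → ℝ} {K : ℝ} (hg : IntegrableOn g (Ioi 0))
    (hK : ∀ t > 0, |g t| ≤ K) : MemLp g 2 (volume.restrict (Ioi 0)) := by
  rw [memLp_two_iff_integrable_sq hg.aestronglyMeasurable]
  simp_rw [sq]
  exact Integrable.mul_bdd (c := K) hg hg.aestronglyMeasurable
    ((ae_restrict_iff' measurableSet_Ioi).2 (.of_forall fun t ht => hK t ht))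

/-- Kernels whose Laplace transform has nonnegative real part are of positive type. -/
theorem Assumption1.integral_mul_causalConv_nonneg {b b' : ℝ → ℝ} {ρ : ℝ}
    (hb : Assumption1 b b' ρ) {f : ℝ → ℝ} {ε M : ℝ} (hε : 0 < ε)
    (hf : IntegrableOn (fun t => Real.exp (-ε * t) * f t) (Ioi 0)) (hM : ∀ t > 0, |f t| ≤ M) :
    0 ≤ ∫ t in Ioi 0, (Real.exp (-ε * t) * f t) * (Real.exp (-ε * t) * causalConv b f t) := by
  have hbi := hb.integrableOn_exp_mul hε
  have hc := integrableOn_exp_mul_causalConv hbi hf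
  have hf2 : MemLp (fun t => Real.exp (-ε * t) * f t) 2 (volume.restrict (Ioi 0)) :=
    memLp_two_of_integrableOn_of_abs_le (K := M) hf fun t ht => by
      rw [abs_mul, Real.abs_exp]
      refine (mul_le_of_le_one_left (abs_nonneg _) ?_).trans (hM t ht)
      rw [Real.exp_le_one_iff]
      nlinarith
  have hc2 : MemLp (fun t => Real.exp (-ε * t) * causalConv b f t) 2 (volume.restrict (Ioi 0)) :=
    memLp_two_of_integrableOn_of_abs_le hc fun t ht =>
      abs_exp_mul_causalConv_le hε hb.nonneg hbi hM ht
  have hP := lintegral_enorm_laplaceTransform_sq (f := fun t => f t + causalConv b f t) (ε := ε)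
    (by simp_rw [mul_add]; exact hf.add hc) (by simp_rw [mul_add]; exact hf2.add hc2)
  have hQ := lintegral_enorm_laplaceTransform_sq (f := fun t => f t - causalConv b f t) (ε := ε)
    (by simp_rw [mul_sub]; exact hf.sub hc) (by simp_rw [mul_sub]; exact hf2.sub hc2)
  have hle : ∫⁻ ω : ℝ, ‖laplaceTransform (fun t => f t - causalConv b f t)
        (ε + ω * Complex.I)‖ₑ ^ 2 ≤
      ∫⁻ ω : ℝ, ‖laplaceTransform (fun t => f t + causalConv b f t) (ε + ω * Complex.I)‖ₑ ^ 2 := by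
    refine lintegral_mono fun ω => ?_
    set z : ℂ := ε + ω * Complex.I with hzdef
    have hzre : z.re = ε := by simp [hzdef]
    have hz : 0 < z.re := by rwa [hzre]
    rw [← hzre] at hf hbi hc
    have hfi := integrableOn_cexp_mul_of_integrableOn hf
    have hci := integrableOn_cexp_mul_of_integrableOn hc
    have e1 : laplaceTransform (fun t => f t + causalConv b f t) z =
        (1 + laplaceTransform b z) * laplaceTransform f z := by
      rw [add_mul, one_mul, ← laplaceTransform_causalConv hbi hf, laplaceTransform,
        laplaceTransform, laplaceTransform, ← integral_add hfi hci]
      simp [mul_add]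
    have e2 : laplaceTransform (fun t => f t - causalConv b f t) z =
        (1 - laplaceTransform b z) * laplaceTransform f z := by
      rw [sub_mul, one_mul, ← laplaceTransform_causalConv hbi hf, laplaceTransform,
        laplaceTransform, laplaceTransform, ← integral_sub hfi hci]
      simp [mul_sub]
    simp only [e1, e2]
    rw [enorm_mul, enorm_mul]
    gcongr
    rw [← ofReal_norm, ← ofReal_norm]
    refine ENNReal.ofReal_le_ofReal ?_
    rw [← sq_le_sq₀ (norm_nonneg _) (norm_nonneg _), ← Complex.normSq_eq_norm_sq,
      ← Complex.normSq_eq_norm_sq, Complex.normSq_apply, Complex.normSq_apply]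
    have := hb.re_nonneg hz
    simp
    nlinarith
  rw [hP, hQ] at hle
  have h2 := (ENNReal.mul_le_mul_iff_right (by simp [Real.pi_pos]) ENNReal.ofReal_ne_top).1 hle
  have hp2 : Integrable (fun t => (Real.exp (-ε * t) * (f t + causalConv b f t)) ^ 2)
      (volume.restrict (Ioi 0)) := by
    simp_rw [mul_add]; exact (hf2.add hc2).integrable_sq
  have hm2 : Integrable (fun t => (Real.exp (-ε * t) * (f t - causalConv b f t)) ^ 2)
      (volume.restrict (Ioi 0)) := by
    simp_rw [mul_sub]; exact (hf2.sub hc2).integrable_sq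
  rw [← ofReal_integral_eq_lintegral_ofReal hp2 (.of_forall fun t => sq_nonneg _),
    ← ofReal_integral_eq_lintegral_ofReal hm2 (.of_forall fun t => sq_nonneg _),
    ENNReal.ofReal_le_ofReal_iff (integral_nonneg fun t => sq_nonneg _), ← sub_nonneg,
    ← integral_sub hp2 hm2] at h2
  have h3 : ∀ t, (Real.exp (-ε * t) * (f t + causalConv b f t)) ^ 2 -
      (Real.exp (-ε * t) * (f t - causalConv b f t)) ^ 2 =
      4 * ((Real.exp (-ε * t) * f t) * (Real.exp (-ε * t) * causalConv b f t)) := fun t => by ring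
  simp_rw [h3, integral_const_mul] at h2
  linarith

namespace IsScalarSolution

variable {b b' s s' : ℝ → ℝ} {ρ l : ℝ}

theorem deriv_eq (hs : IsScalarSolution b l s s') {t : ℝ} (ht : 0 < t) :
    s' t = -(l * causalConv b s t) := by
  have := hs.eqn t ht
  rw [causalConv]
  linarith

theorem aestronglyMeasurable (hs : IsScalarSolution b l s s') :
    AEStronglyMeasurable s (volume.restrict (Ioi 0)) :=
  (hs.cont.mono Ioi_subset_Ici_self).aestronglyMeasurable measurableSet_Ioi

theorem abs_le_exp (hs : IsScalarSolution b l s s') (hb : Assumption1 b b' ρ) (hl : 0 < l)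
    {ε T : ℝ} (hε : 0 < ε) (hT : 0 < T) : |s T| ≤ Real.exp (ε * T) := by
  have hcont : ContinuousOn s (Icc 0 T) := hs.cont.mono Icc_subset_Ici_self
  obtain ⟨M, hM⟩ := isCompact_Icc.exists_bound_of_continuousOn hcont
  set f : ℝ → ℝ := (Iic T).indicator s with hf
  have hfs : ∀ t, 0 < t → t ≤ T → f t = s t := fun t _ h =>
    indicator_of_mem (mem_Iic.2 h) s
  have hf0 : ∀ t, T < t → f t = 0 := fun t h => indicator_of_notMem (by simpa using h) s
  have hM0 : 0 ≤ M := (norm_nonneg _).trans (hM 0 (by simp [hT.le]))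
  have hfM : ∀ t > 0, |f t| ≤ M := by
    intro t ht
    rcases le_or_gt t T with h | h
    · rw [hfs t ht h]; exact hM t ⟨ht.le, h⟩
    · rw [hf0 t h]; simpa using hM0
  have hfi : IntegrableOn (fun t => Real.exp (-ε * t) * f t) (Ioi 0) := by
    refine Integrable.mul_bdd (c := M) (integrableOn_exp_mul_Ioi (by linarith) 0)
      (hs.aestronglyMeasurable.indicator measurableSet_Iic) ?_
    exact (ae_restrict_iff' measurableSet_Ioi).2 (.of_forall fun t ht => hfM t ht)
  have hpos := hb.integral_mul_causalConv_nonneg hε hfi hfM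
  have hci := integrableOn_exp_mul_causalConv (hb.integrableOn_exp_mul hε) hfi
  have hcc : ∀ t, 0 < t → t ≤ T → causalConv b f t = causalConv b s t := by
    intro t ht htT
    refine intervalIntegral.integral_congr_ae (.of_forall fun u hu => ?_)
    rw [uIoc_of_le ht.le] at hu
    rw [hfs u hu.1 (hu.2.trans htT)]
  have hci' : IntegrableOn (fun t => Real.exp (-ε * t) * causalConv b s t) (Ioc 0 T) :=
    (hci.mono_set Ioc_subset_Ioi_self).congr_fun (fun t ht => by simp only [hcc t ht.1 ht.2])
      measurableSet_Ioc
  have hpos' : 0 ≤ ∫ t in Ioc 0 T,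
      (Real.exp (-ε * t) * s t) * (Real.exp (-ε * t) * causalConv b s t) := by
    rw [← Ioc_union_Ioi_eq_Ioi hT.le] at hpos
    rw [setIntegral_eq_of_subset_of_forall_sdiff_eq_zero (s := Ioc 0 T) (by measurability)
      subset_union_left] at hpos
    · refine hpos.trans_eq (setIntegral_congr_fun measurableSet_Ioc fun t ht => ?_)
      simp only [hcc t ht.1 ht.2, hfs t ht.1 ht.2]
    · rintro t ⟨h1 | h1, h2⟩
      · exact absurd h1 h2
      · simp [hf0 t h1]
  have hes : ContinuousOn (fun t => Real.exp (-ε * t) * s t) (Icc 0 T) :=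
    ContinuousOn.mul (by fun_prop) hcont
  have hscI : IntegrableOn (fun t => (Real.exp (-ε * t) * s t) *
      (Real.exp (-ε * t) * causalConv b s t)) (Ioc 0 T) := by
    refine Integrable.bdd_mul (c := M) hci'
      ((hes.mono Ioc_subset_Icc_self).aestronglyMeasurable measurableSet_Ioc) ?_
    refine (ae_restrict_iff' measurableSet_Ioc).2 (.of_forall fun t ht => ?_)
    rw [norm_mul, Real.norm_eq_abs, Real.abs_exp]
    refine (mul_le_of_le_one_left (norm_nonneg _) ?_).trans (hM t ⟨ht.1.le, ht.2⟩)
    rw [Real.exp_le_one_iff]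
    nlinarith [ht.1]
  have hssI : IntegrableOn (fun t => (Real.exp (-ε * t) * s t) ^ 2) (Ioc 0 T) :=
    ((hes.pow 2).integrableOn_Icc).mono_set Ioc_subset_Icc_self
  have hder : ∀ t ∈ Ioo 0 T, HasDerivAt (fun t => (Real.exp (-ε * t) * s t) ^ 2)
      (-(2 * l) * ((Real.exp (-ε * t) * s t) * (Real.exp (-ε * t) * causalConv b s t)) -
        (2 * ε) * (Real.exp (-ε * t) * s t) ^ 2) t := by
    intro t ht
    have h1 : HasDerivAt (fun t : ℝ => Real.exp (-ε * t)) (Real.exp (-ε * t) * (-ε)) t := by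
      simpa using ((hasDerivAt_id t).const_mul (-ε)).exp
    have h2 := (h1.mul (hs.hasDeriv t ht.1)).pow 2
    rw [hs.deriv_eq ht.1] at h2
    refine h2.congr_deriv ?_
    simp
    ring
  have hFTC := intervalIntegral.integral_eq_sub_of_hasDerivAt_of_le hT.le (hes.pow 2) hder
    ((intervalIntegrable_iff_integrableOn_Ioc_of_le hT.le).2
      ((hscI.const_mul _).sub (hssI.const_mul _)))
  rw [intervalIntegral.integral_of_le hT.le,
    integral_sub (hscI.const_mul _) (hssI.const_mul _), integral_const_mul,
    integral_const_mul] at hFTC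
  have hss0 : 0 ≤ ∫ t in Ioc 0 T, (Real.exp (-ε * t) * s t) ^ 2 :=
    integral_nonneg fun t => sq_nonneg _
  have h1 : (Real.exp (-ε * T) * s T) ^ 2 ≤ 1 := by
    have := mul_nonneg hl.le hpos'
    have := mul_nonneg hε.le hss0
    simp only [Pi.pow_apply, hs.init, mul_zero, Real.exp_zero, mul_one, one_pow] at hFTC
    linarith
  rw [sq_le_one_iff_abs_le_one, abs_mul, Real.abs_exp, neg_mul, Real.exp_neg,
    inv_mul_le_one₀ (Real.exp_pos _)] at h1
  exact h1

/-- The scalar resolvents are bounded by one. -/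
theorem abs_le_one (hs : IsScalarSolution b l s s') (hb : Assumption1 b b' ρ) (hl : 0 < l)
    {T : ℝ} (hT : 0 < T) : |s T| ≤ 1 := by
  have h : Tendsto (fun ε => Real.exp (ε * T)) (nhdsWithin 0 (Ioi 0)) (nhds 1) := by
    have : Tendsto (fun ε => Real.exp (ε * T)) (nhds 0) (nhds (Real.exp (0 * T))) :=
      Continuous.tendsto (by fun_prop) 0
    rw [zero_mul, Real.exp_zero] at this
    exact this.mono_left nhdsWithin_le_nhds
  exact ge_of_tendsto h (eventually_mem_nhdsWithin.mono fun ε hε => hs.abs_le_exp hb hl hε hT)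

theorem integrableOn_exp_mul (hs : IsScalarSolution b l s s') (hb : Assumption1 b b' ρ)
    (hl : 0 < l) {ε : ℝ} (hε : 0 < ε) :
    IntegrableOn (fun t => Real.exp (-ε * t) * s t) (Ioi 0) :=
  Integrable.mul_bdd (c := 1) (integrableOn_exp_mul_Ioi (by linarith) 0) hs.aestronglyMeasurable
    ((ae_restrict_iff' measurableSet_Ioi).2 (.of_forall fun _ ht => hs.abs_le_one hb hl ht))

theorem abs_exp_mul_le (hs : IsScalarSolution b l s s') (hb : Assumption1 b b' ρ)
    (hl : 0 < l) {ε : ℝ} (hε : 0 < ε) {t : ℝ} (ht : 0 < t) : |Real.exp (-ε * t) * s t| ≤ 1 := by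
  rw [abs_mul, Real.abs_exp]
  refine mul_le_one₀ ?_ (abs_nonneg _) (hs.abs_le_one hb hl ht)
  rw [Real.exp_le_one_iff]
  nlinarith

theorem laplaceTransform_mul (hs : IsScalarSolution b l s s') (hb : Assumption1 b b' ρ)
    (hl : 0 < l) {z : ℂ} (hz : 0 < z.re) :
    laplaceTransform s z * (z + l * laplaceTransform b z) = 1 := by
  have hsi := hs.integrableOn_exp_mul hb hl hz
  have hbi := hb.integrableOn_exp_mul hz
  have hci := integrableOn_exp_mul_causalConv hbi hsi
  have hsI := integrableOn_cexp_mul_of_integrableOn hsi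
  have hcI := integrableOn_cexp_mul_of_integrableOn hci
  have hE : ContinuousOn (fun t : ℝ => Complex.exp (-z * t) * (s t : ℂ)) (Ici 0) :=
    ContinuousOn.mul (by fun_prop) (Complex.continuous_ofReal.comp_continuousOn hs.cont)
  have hder : ∀ t ∈ Ioi (0 : ℝ), HasDerivAt (fun t : ℝ => Complex.exp (-z * t) * (s t : ℂ))
      (-z * (Complex.exp (-z * t) * (s t : ℂ)) -
        l * (Complex.exp (-z * t) * (causalConv b s t : ℂ))) t := by
    intro t ht
    have h1 : HasDerivAt (fun t : ℝ => Complex.exp (-z * t)) (Complex.exp (-z * t) * (-z)) t := by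
      simpa using ((Complex.ofRealCLM.hasDerivAt (x := t)).const_mul (-z)).cexp
    have h2 := h1.mul (hs.hasDeriv t ht).ofReal_comp
    rw [hs.deriv_eq ht] at h2
    refine h2.congr_deriv ?_
    push_cast
    ring
  have hlim : Tendsto (fun t : ℝ => Complex.exp (-z * t) * (s t : ℂ)) atTop (nhds 0) := by
    have h3 : Tendsto (fun t : ℝ => Real.exp (-(z.re * t))) atTop (nhds 0) :=
      Real.tendsto_exp_neg_atTop_nhds_zero.comp (tendsto_id.const_mul_atTop hz)
    refine squeeze_zero_norm' ?_ h3
    filter_upwards [eventually_gt_atTop 0] with t ht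
    rw [norm_mul, norm_exp_neg_mul_ofReal, Complex.norm_real, neg_mul]
    exact mul_le_of_le_one_right (Real.exp_pos _).le (hs.abs_le_one hb hl ht)
  have h := integral_Ioi_of_hasDerivAt_of_tendsto (hE 0 self_mem_Ici) hder
    ((hsI.const_mul _).sub (hcI.const_mul _)) hlim
  rw [integral_sub (hsI.const_mul _) (hcI.const_mul _), integral_const_mul, integral_const_mul] at h
  have h4 := laplaceTransform_causalConv hbi hsi
  rw [laplaceTransform] at h4
  rw [h4, ← laplaceTransform] at h
  simp only [hs.init, Complex.ofReal_zero, mul_zero, Complex.exp_zero, Complex.ofReal_one,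
    mul_one] at h
  linear_combination -h

/-- The Laplace transform of a scalar resolvent. -/
theorem laplaceTransform_eq (hs : IsScalarSolution b l s s') (hb : Assumption1 b b' ρ)
    (hl : 0 < l) {z : ℂ} (hz : 0 < z.re) :
    laplaceTransform s z = (z + l * laplaceTransform b z)⁻¹ :=
  eq_inv_of_mul_eq_one_left (hs.laplaceTransform_mul hb hl hz)

end IsScalarSolution

theorem lintegral_le_of_forall_exp_mul_le {F : ℝ → ℝ≥0∞} {B : ℝ≥0∞}
    (hF : AEMeasurable F (volume.restrict (Ioi 0)))
    (h : ∀ ε : ℝ, 0 < ε → ε ≤ 1 →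
      ∫⁻ t in Ioi 0, ENNReal.ofReal (Real.exp (-ε * t) ^ 2) * F t ≤ B) :
    ∫⁻ t in Ioi 0, F t ≤ B := by
  have hlim : ∀ t, Tendsto (fun n : ℕ =>
      ENNReal.ofReal (Real.exp (-(1 / ((n : ℝ) + 1)) * t) ^ 2) * F t) atTop (nhds (F t)) := by
    intro t
    have h1 : Tendsto (fun n : ℕ => ENNReal.ofReal (Real.exp (-(1 / ((n : ℝ) + 1)) * t) ^ 2))
        atTop (nhds 1) := by
      have h2 : Tendsto (fun ε : ℝ => ENNReal.ofReal (Real.exp (-ε * t) ^ 2)) (nhds 0)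
          (nhds (ENNReal.ofReal (Real.exp (-0 * t) ^ 2))) :=
        (ENNReal.continuous_ofReal.comp (by fun_prop :
          Continuous fun ε : ℝ => Real.exp (-ε * t) ^ 2)).tendsto 0
      simp only [neg_zero, zero_mul, Real.exp_zero, one_pow, ENNReal.ofReal_one] at h2
      exact h2.comp tendsto_one_div_add_atTop_nhds_zero_nat
    simpa using ENNReal.Tendsto.mul_const h1 (.inl one_ne_zero)
  calc ∫⁻ t in Ioi 0, F t = ∫⁻ t in Ioi 0, liminf (fun n : ℕ =>
        ENNReal.ofReal (Real.exp (-(1 / ((n : ℝ) + 1)) * t) ^ 2) * F t) atTop := by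
        simp_rw [fun t => (hlim t).liminf_eq]
    _ ≤ liminf (fun n : ℕ => ∫⁻ t in Ioi 0,
        ENNReal.ofReal (Real.exp (-(1 / ((n : ℝ) + 1)) * t) ^ 2) * F t) atTop :=
        lintegral_liminf_le' fun n => AEMeasurable.mul (by fun_prop) hF
    _ ≤ B := liminf_le_of_le (by isBoundedDefault) fun c hc => by
        obtain ⟨n, hn⟩ := hc.exists
        refine hn.trans (h _ (by positivity) ?_)
        rw [div_le_one (by positivity)]
        linarith [n.cast_nonneg (α := ℝ)]

/-- The mean square decay of the scalar resolvents. -/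
theorem Assumption1.exists_lintegral_sq_le {b b' : ℝ → ℝ} {ρ : ℝ} (hb : Assumption1 b b' ρ)
    {l₀ : ℝ} (hl₀ : 0 < l₀) :
    ∃ C > 0, ∀ l : ℝ, l₀ ≤ l → ∀ s s' : ℝ → ℝ, IsScalarSolution b l s s' →
      ∫⁻ t in Ioi 0, ENNReal.ofReal (s t ^ 2) ≤ ENNReal.ofReal (C * l ^ (-(1 / ρ))) := by
  obtain ⟨C, hC, H⟩ := hb.exists_lintegral_inv_le hl₀
  refine ⟨C, hC, fun l hl s s' hs => ?_⟩
  have hl0 : 0 < l := hl₀.trans_le hl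
  have hpi : (1 : ℝ) ≤ 2 * Real.pi := by linarith [Real.pi_gt_three]
  refine lintegral_le_of_forall_exp_mul_le ?_ fun ε hε hε1 => ?_
  · exact (hs.aestronglyMeasurable.aemeasurable.pow_const 2).ennreal_ofReal
  · have hsi := hs.integrableOn_exp_mul hb hl0 hε
    have hP := lintegral_enorm_laplaceTransform_sq hsi
      (memLp_two_of_integrableOn_of_abs_le hsi fun t ht => hs.abs_exp_mul_le hb hl0 hε ht)
    simp_rw [fun ω : ℝ => hs.laplaceTransform_eq hb hl0
      (show 0 < ((ε : ℂ) + ω * Complex.I).re by simpa using hε)] at hP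
    calc _ = ∫⁻ t in Ioi 0, ENNReal.ofReal ((Real.exp (-ε * t) * s t) ^ 2) := by
          simp_rw [mul_pow, fun t => ENNReal.ofReal_mul (q := s t ^ 2)
            (sq_nonneg (Real.exp (-ε * t)))]
      _ ≤ ENNReal.ofReal (2 * Real.pi) *
            ∫⁻ t in Ioi 0, ENNReal.ofReal ((Real.exp (-ε * t) * s t) ^ 2) :=
          le_mul_of_one_le_left' (ENNReal.one_le_ofReal.2 hpi)
      _ ≤ _ := hP ▸ H l hl ε hε hε1

section HilbertBasisCoordinates

variable {H : Type*} [NormedAddCommGroup H] [InnerProductSpace ℝ H] (e : HilbertBasis ℕ ℝ H)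

theorem hasSum_inner_sq (v : H) : HasSum (fun k => ⟪v, e k⟫ ^ 2) (‖v‖ ^ 2) := by
  have h := e.hasSum_inner_mul_inner v v
  rw [real_inner_self_eq_norm_sq] at h
  refine h.congr_fun fun k => ?_
  rw [sq, real_inner_comm]

theorem hasSum_inner_mul_inner_right (v w : H) :
    HasSum (fun k => ⟪v, e k⟫ * ⟪w, e k⟫) ⟪v, w⟫ := by
  refine (e.hasSum_inner_mul_inner v w).congr_fun fun k => ?_
  rw [real_inner_comm w]

theorem ofReal_norm_sq_eq_tsum (v : H) :
    ENNReal.ofReal (‖v‖ ^ 2) = ∑' k, ENNReal.ofReal (⟪v, e k⟫ ^ 2) := by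
  rw [← (hasSum_inner_sq e v).tsum_eq,
    ENNReal.ofReal_tsum_of_nonneg (fun k => sq_nonneg _) (hasSum_inner_sq e v).summable]

theorem exists_forall_inner_eq (c : ℕ → ℝ) (hc : Summable fun k => c k ^ 2) :
    ∃ v : H, (∀ k, ⟪v, e k⟫ = c k) ∧ HasSum (fun k => c k • e k) v := by
  have hm : Memℓp c 2 := by
    refine memℓp_gen ?_
    simpa using hc
  refine ⟨e.repr.symm ⟨c, hm⟩, fun k => ?_, ?_⟩
  · rw [real_inner_comm, ← e.repr_apply_apply]; simp
  · simpa using e.hasSum_repr_symm ⟨c, hm⟩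

theorem exists_forall_inner_eq_mul (x : H) (c : ℕ → ℝ) {M : ℝ} (hc : ∀ k, |c k| ≤ M) :
    ∃ v : H, (∀ k, ⟪v, e k⟫ = c k * ⟪x, e k⟫) ∧
      HasSum (fun k => (c k * ⟪x, e k⟫) • e k) v := by
  refine exists_forall_inner_eq e (fun k => c k * ⟪x, e k⟫) ?_
  refine Summable.of_nonneg_of_le (fun k => sq_nonneg _) (fun k => ?_)
    ((hasSum_inner_sq e x).summable.mul_left (M ^ 2))
  rw [mul_pow]
  refine mul_le_mul_of_nonneg_right ?_ (sq_nonneg _)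
  rw [← sq_abs]
  exact pow_le_pow_left₀ (abs_nonneg _) (hc k) 2

end HilbertBasisCoordinates

namespace FESetup

variable {H : Type*} [NormedAddCommGroup H] [InnerProductSpace ℝ H] {e : HilbertBasis ℕ ℝ H}
  {lam : ℕ → ℝ} {N : ℕ} {f : Fin N → H} {μ : Fin N → ℝ}

theorem summable_sq (hf : FESetup e lam N f μ) (hlam : ∀ k, 0 < lam k) (j : Fin N) :
    Summable fun k => lam k * ⟪f j, e k⟫ ^ 2 := by
  have h0 : ∀ k, 0 ≤ lam k * ⟪f j, e k⟫ ^ 2 := fun k => mul_nonneg (hlam k).le (sq_nonneg _)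
  refine (ENNReal.summable_toReal (hf.f_dom j).ne).congr fun k => ?_
  rw [ENNReal.toReal_ofReal (h0 k)]

theorem summable_mul (hf : FESetup e lam N f μ) (hlam : ∀ k, 0 < lam k) (j j' : Fin N) :
    Summable fun k => lam k * ⟪f j, e k⟫ * ⟪f j', e k⟫ := by
  refine Summable.of_norm_bounded ((hf.summable_sq hlam j).add (hf.summable_sq hlam j'))
    fun k => ?_
  rw [Real.norm_eq_abs, mul_assoc, abs_mul, abs_of_pos (hlam k), ← mul_add]
  refine mul_le_mul_of_nonneg_left ?_ (hlam k).le
  rw [abs_le]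
  constructor <;> nlinarith [sq_nonneg (⟪f j, e k⟫ + ⟪f j', e k⟫),
    sq_nonneg (⟪f j, e k⟫ - ⟪f j', e k⟫), sq_nonneg ⟪f j, e k⟫, sq_nonneg ⟪f j', e k⟫]

theorem inner_sum_smul (hf : FESetup e lam N f μ) (c : Fin N → ℝ) (j : Fin N) :
    ⟪∑ i, c i • f i, f j⟫ = c j := by
  simpa using hf.f_orth.inner_left_fintype c j

theorem norm_sum_smul_sq (hf : FESetup e lam N f μ) (c : Fin N → ℝ) :
    ‖∑ i, c i • f i‖ ^ 2 = ∑ i, c i ^ 2 := by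
  rw [← real_inner_self_eq_norm_sq, inner_sum]
  refine Finset.sum_congr rfl fun i _ => ?_
  rw [real_inner_smul_right, hf.inner_sum_smul, sq]

theorem hasSum_energy (hf : FESetup e lam N f μ) (hlam : ∀ k, 0 < lam k) (c : Fin N → ℝ)
    (j : Fin N) :
    HasSum (fun k => lam k * ⟪∑ i, c i • f i, e k⟫ * ⟪f j, e k⟫) (μ j * c j) := by
  have h := hasSum_sum (s := Finset.univ) fun (i : Fin N) _ =>
    ((hf.summable_mul hlam i j).hasSum.mul_left (c i))
  have e1 : ∑ i, c i * ∑' k, lam k * ⟪f i, e k⟫ * ⟪f j, e k⟫ = μ j * c j := by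
    rw [Finset.sum_eq_single j]
    · rw [hf.eigen, real_inner_self_eq_norm_sq, hf.f_orth.1]; ring
    · intro i _ hij
      rw [hf.eigen, hf.f_orth.2 hij]; ring
    · simp
  rw [e1] at h
  refine h.congr_fun fun k => ?_
  rw [sum_inner, Finset.mul_sum, Finset.sum_mul]
  refine Finset.sum_congr rfl fun i _ => ?_
  rw [real_inner_smul_left]; ring

theorem hasSum_energy_sq (hf : FESetup e lam N f μ) (hlam : ∀ k, 0 < lam k) (c : Fin N → ℝ) :
    HasSum (fun k => lam k * ⟪∑ i, c i • f i, e k⟫ ^ 2) (∑ j, μ j * c j ^ 2) := by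
  have h := hasSum_sum (s := Finset.univ) fun (j : Fin N) _ =>
    ((hf.hasSum_energy hlam c j).mul_left (c j))
  have e1 : ∑ j, c j * (μ j * c j) = ∑ j, μ j * c j ^ 2 :=
    Finset.sum_congr rfl fun j _ => by ring
  rw [e1] at h
  refine h.congr_fun fun k => ?_
  have e2 : ⟪∑ i, c i • f i, e k⟫ = ∑ j, c j * ⟪f j, e k⟫ := by
    rw [sum_inner]
    exact Finset.sum_congr rfl fun i _ => real_inner_smul_left _ _ _
  rw [sq, ← mul_assoc]
  conv_lhs => rw [e2, Finset.mul_sum, ← e2]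
  exact Finset.sum_congr rfl fun j _ => by ring

theorem le_mu (hf : FESetup e lam N f μ) (hlam : ∀ k, 0 < lam k) (hmono : Monotone lam)
    (j : Fin N) : lam 0 ≤ μ j := by
  have h := hf.eigen j j
  rw [real_inner_self_eq_norm_sq, hf.f_orth.1, one_pow, mul_one] at h
  have h1 := (hasSum_inner_sq e (f j)).mul_left (lam 0)
  rw [hf.f_orth.1, one_pow, mul_one] at h1
  rw [← h, ← h1.tsum_eq]
  refine h1.summable.tsum_le_tsum (fun k => ?_) (hf.summable_mul hlam j j)
  rw [mul_assoc, ← sq]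
  exact mul_le_mul_of_nonneg_right (hmono k.zero_le) (sq_nonneg _)

/-- Compressing `(1 + tA)⁻¹` to the discrete space dominates the discrete resolvent. -/
theorem sum_inv_one_add_le (hf : FESetup e lam N f μ) (hlam : ∀ k, 0 < lam k) {t : ℝ} (ht : 0 < t)
    (x : H) : ENNReal.ofReal (∑ j, (1 + t * μ j)⁻¹ * ⟪x, f j⟫ ^ 2) ≤
      ∑' k, ENNReal.ofReal ((1 + t * lam k)⁻¹ * ⟪x, e k⟫ ^ 2) := by
  have hd : ∀ k, 0 < 1 + t * lam k := fun k => by have := mul_pos ht (hlam k); linarith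
  have hdj : ∀ j, 0 < 1 + t * μ j := fun j => by have := mul_pos ht (hf.mu_pos j); linarith
  have h0 : ∀ k, 0 ≤ (1 + t * lam k)⁻¹ * ⟪x, e k⟫ ^ 2 := fun k =>
    mul_nonneg (inv_pos.2 (hd k)).le (sq_nonneg _)
  have hsum : Summable fun k => (1 + t * lam k)⁻¹ * ⟪x, e k⟫ ^ 2 := by
    refine Summable.of_nonneg_of_le h0 (fun k => ?_) (hasSum_inner_sq e x).summable
    refine mul_le_of_le_one_left (sq_nonneg _) (inv_le_one_of_one_le₀ ?_)
    have := mul_pos ht (hlam k)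
    linarith
  rw [← ENNReal.ofReal_tsum_of_nonneg h0 hsum]
  refine ENNReal.ofReal_le_ofReal ?_
  set c : Fin N → ℝ := fun j => (1 + t * μ j)⁻¹ * ⟪x, f j⟫ with hc
  set u : H := ∑ j, c j • f j with hu
  have h1 := (hasSum_inner_sq e u).add ((hf.hasSum_energy_sq hlam c).mul_left t)
  have h2 := hasSum_inner_mul_inner_right e x u
  have e1 : ‖u‖ ^ 2 + t * ∑ j, μ j * c j ^ 2 = ∑ j, (1 + t * μ j)⁻¹ * ⟪x, f j⟫ ^ 2 := by
    rw [hf.norm_sum_smul_sq, Finset.mul_sum, ← Finset.sum_add_distrib]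
    refine Finset.sum_congr rfl fun j _ => ?_
    have := (hdj j).ne'
    simp only [hc]
    field_simp
  have e2 : ⟪x, u⟫ = ∑ j, (1 + t * μ j)⁻¹ * ⟪x, f j⟫ ^ 2 := by
    rw [hu, inner_sum]
    refine Finset.sum_congr rfl fun j _ => ?_
    rw [real_inner_smul_right]; simp only [hc]; ring
  rw [e1] at h1
  rw [e2] at h2
  have h3 := hasSum_le (f := fun k => 2 * (⟪x, e k⟫ * ⟪u, e k⟫)) (fun k => ?_) (h2.mul_left 2)
    (hsum.hasSum.add h1)
  · linarith
  · have h4 := hd k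
    have h5 := mul_nonneg (inv_pos.2 h4).le (sq_nonneg (⟪x, e k⟫ - (1 + t * lam k) * ⟪u, e k⟫))
    have h6 : (1 + t * lam k)⁻¹ * (⟪x, e k⟫ - (1 + t * lam k) * ⟪u, e k⟫) ^ 2 =
        (1 + t * lam k)⁻¹ * ⟪x, e k⟫ ^ 2 + (⟪u, e k⟫ ^ 2 + t * (lam k * ⟪u, e k⟫ ^ 2)) -
          2 * (⟪x, e k⟫ * ⟪u, e k⟫) := by
      field_simp; ring
    rw [h6] at h5
    linarith

end FESetup

theorem ofReal_rpow_neg_eq_lintegral {α l : ℝ} (hα : α ∈ Ioo (0 : ℝ) 1) (hl : 0 < l) :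
    ENNReal.ofReal (l ^ (-α)) =
      ENNReal.ofReal (∫ t in Ioi 0, Real.rpowIntegrand₀₁ α t 1)⁻¹ *
        ∫⁻ t in Ioi 0, ENNReal.ofReal (t ^ (α - 1)) * ENNReal.ofReal ((1 + t * l)⁻¹) := by
  have hl' : 0 ≤ l⁻¹ := (inv_pos.2 hl).le
  have hK : 0 ≤ (∫ t in Ioi 0, Real.rpowIntegrand₀₁ α t 1)⁻¹ :=
    inv_nonneg.2 (setIntegral_nonneg measurableSet_Ioi fun t ht =>
      Real.rpowIntegrand₀₁_nonneg hα.1 (le_of_lt ht) zero_le_one)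
  rw [Real.rpow_neg hl.le, ← Real.inv_rpow hl.le, Real.rpow_eq_const_mul_integral hα hl',
    ENNReal.ofReal_mul hK, ofReal_integral_eq_lintegral_ofReal
      (Real.integrableOn_rpowIntegrand₀₁_Ioi hα hl')
      ((ae_restrict_iff' measurableSet_Ioi).2 (.of_forall fun t ht =>
        Real.rpowIntegrand₀₁_nonneg hα.1 (le_of_lt ht) hl'))]
  congr 1
  refine setLIntegral_congr_fun measurableSet_Ioi fun t ht => ?_
  have ht : 0 < t := ht
  rw [Real.rpowIntegrand₀₁_eq_pow_div hα ht.le hl', ← ENNReal.ofReal_mul (by positivity)]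
  congr 1
  field_simp
  ring

/-- The discrete negative fractional powers are dominated by the continuous ones. -/
theorem FESetup.sum_rpow_le {H : Type*} [NormedAddCommGroup H] [InnerProductSpace ℝ H]
    {e : HilbertBasis ℕ ℝ H} {lam : ℕ → ℝ} {N : ℕ} {f : Fin N → H} {μ : Fin N → ℝ}
    (hf : FESetup e lam N f μ) (hlam : ∀ k, 0 < lam k) {α : ℝ} (hα : α ∈ Ioo (0 : ℝ) 1) (x : H) :
    ∑ j, ENNReal.ofReal (μ j ^ (-α) * ⟪x, f j⟫ ^ 2) ≤
      ∑' k, ENNReal.ofReal (lam k ^ (-α) * ⟪x, e k⟫ ^ 2) := by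
  set K := ENNReal.ofReal (∫ t in Ioi 0, Real.rpowIntegrand₀₁ α t 1)⁻¹ with hK
  have hrep : ∀ l > 0, ∀ y : ℝ, ENNReal.ofReal (l ^ (-α) * y ^ 2) =
      K * ∫⁻ t in Ioi 0, ENNReal.ofReal (t ^ (α - 1)) *
        ENNReal.ofReal ((1 + t * l)⁻¹ * y ^ 2) := by
    intro l hl y
    rw [ENNReal.ofReal_mul (Real.rpow_pos_of_pos hl _).le, ofReal_rpow_neg_eq_lintegral hα hl,
      mul_assoc, ← lintegral_mul_const _ (by fun_prop)]
    congr 1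
    refine setLIntegral_congr_fun measurableSet_Ioi fun t ht => ?_
    have ht : 0 < t := ht
    rw [mul_assoc, ← ENNReal.ofReal_mul (by positivity)]
  simp_rw [fun j => hrep (μ j) (hf.mu_pos j), fun k => hrep (lam k) (hlam k)]
  rw [← Finset.mul_sum, ENNReal.tsum_mul_left, ← lintegral_finsetSum _ (fun j _ => by fun_prop),
    ← lintegral_tsum (fun k => by fun_prop)]
  refine mul_le_mul_right (setLIntegral_mono' measurableSet_Ioi fun t ht => ?_) _
  have ht : 0 < t := ht
  rw [← Finset.mul_sum, ENNReal.tsum_mul_left,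
    ← ENNReal.ofReal_sum_of_nonneg fun j _ => mul_nonneg (inv_nonneg.2
      (by have := mul_pos ht (hf.mu_pos j); linarith)) (sq_nonneg _)]
  exact mul_le_mul_right (hf.sum_inv_one_add_le hlam ht x) _

/-- The second order Ritz projection bound, in terms of the discrete solution operator. -/
theorem FESetup.norm_sub_sum_le {H : Type*} [NormedAddCommGroup H] [InnerProductSpace ℝ H]
    {e : HilbertBasis ℕ ℝ H} {lam : ℕ → ℝ} {N : ℕ} {f : Fin N → H} {μ : Fin N → ℝ}
    (hf : FESetup e lam N f μ) (hlam : ∀ k, 0 < lam k) (hmono : Monotone lam) {CR h : ℝ}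
    {Rh : H → H} (hspan : ∀ v : H, Rh v ∈ Submodule.span ℝ (Set.range f))
    (horth : ∀ v : H, (∑' k, ENNReal.ofReal (lam k * ⟪v, e k⟫ ^ 2)) < ⊤ →
      ∀ j, (∑' k, lam k * ⟪Rh v - v, e k⟫ * ⟪f j, e k⟫) = 0)
    (hbound : ∀ γ ∈ Set.Icc (1 : ℝ) 2, ∀ v : H,
      (∑' k, ENNReal.ofReal (lam k ^ γ * ⟪v, e k⟫ ^ 2)) < ⊤ →
      ‖Rh v - v‖ ≤ CR * h ^ γ * Real.sqrt (∑' k, lam k ^ γ * ⟪v, e k⟫ ^ 2))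
    {y w : H} (hyw : ∀ k, lam k * ⟪w, e k⟫ = ⟪y, e k⟫) :
    ‖w - ∑ j, (⟪y, f j⟫ / μ j) • f j‖ ≤ CR * h ^ 2 * ‖y‖ := by
  have hsq : ∀ k, lam k ^ (2 : ℝ) * ⟪w, e k⟫ ^ 2 = ⟪y, e k⟫ ^ 2 := fun k => by
    rw [← hyw k, Real.rpow_two]; ring
  have h2 := hbound 2 ⟨by norm_num, le_rfl⟩ w
    (by simp_rw [hsq, ← ofReal_norm_sq_eq_tsum]; exact ENNReal.ofReal_lt_top)
  simp_rw [hsq, (hasSum_inner_sq e y).tsum_eq] at h2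
  rw [Real.sqrt_sq (norm_nonneg y), Real.rpow_two] at h2
  have hfin : (∑' k, ENNReal.ofReal (lam k * ⟪w, e k⟫ ^ 2)) < ⊤ := by
    refine lt_of_le_of_lt (ENNReal.tsum_le_tsum fun k => ENNReal.ofReal_le_ofReal
      (?_ : _ ≤ (lam 0)⁻¹ * ⟪y, e k⟫ ^ 2)) ?_
    · rw [← hyw k, ← div_eq_inv_mul, le_div_iff₀ (hlam 0)]
      have := mul_le_mul_of_nonneg_left (hmono k.zero_le)
        (mul_nonneg (hlam k).le (sq_nonneg ⟪w, e k⟫))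
      nlinarith
    · simp_rw [ENNReal.ofReal_mul (inv_nonneg.2 (hlam 0).le)]
      rw [ENNReal.tsum_mul_left, ← ofReal_norm_sq_eq_tsum]
      exact ENNReal.mul_lt_top ENNReal.ofReal_lt_top ENNReal.ofReal_lt_top
  obtain ⟨c, hc⟩ := (Submodule.mem_span_range_iff_exists_fun ℝ).1 (hspan w)
  have hcj : ∀ j, c j = ⟪y, f j⟫ / μ j := fun j => by
    have h1 := horth w hfin j
    have h3 := (hf.hasSum_energy hlam c j).sub (hasSum_inner_mul_inner_right e y (f j))
    rw [(h3.congr_fun fun k => ?_).tsum_eq] at h1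
    · rw [eq_div_iff (hf.mu_pos j).ne']; linarith
    · rw [inner_sub_left, ← hyw k, hc]; ring
  simp_rw [← hcj, hc]
  rwa [norm_sub_rev]

/-- Frequency domain estimate: the difference of the continuous and the discrete resolvents is
controlled by the Ritz projection error. -/
theorem FESetup.tsum_norm_sub_sq_le {H : Type*} [NormedAddCommGroup H] [InnerProductSpace ℝ H]
    {e : HilbertBasis ℕ ℝ H} {lam : ℕ → ℝ} {N : ℕ} {f : Fin N → H} {μ : Fin N → ℝ}
    (hf : FESetup e lam N f μ) (hlam : ∀ k, 0 < lam k) (hmono : Monotone lam) {M : ℝ}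
    (hR : ∀ y w : H, (∀ k, lam k * ⟪w, e k⟫ = ⟪y, e k⟫) →
      ‖w - ∑ j, (⟪y, f j⟫ / μ j) • f j‖ ≤ M * ‖y‖)
    {z β : ℂ} {κ : ℝ} (hκ : 0 ≤ κ) (hκ1 : κ < 1) (hz : 0 ≤ z.re) (hβ : 0 ≤ β.re)
    (hβ0 : β ≠ 0) (him : |β.im| ≤ κ * ‖β‖) (x : H) :
    ∑' m, ENNReal.ofReal (‖(z + lam m * β)⁻¹ * ⟪x, e m⟫ -
        ∑ j, (z + μ j * β)⁻¹ * ⟪x, f j⟫ * ⟪f j, e m⟫‖ ^ 2) ≤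
      ENNReal.ofReal (2 * (1 + (1 - κ)⁻¹) * M ^ 2) *
        ∑' m, ENNReal.ofReal (‖(z + lam m * β)⁻¹‖ ^ 2 * (lam m ^ 2 * ⟪x, e m⟫ ^ 2)) := by
  have hκ' : 0 < 1 - κ := by linarith
  have hβn : 0 < ‖β‖ := norm_pos_iff.2 hβ0
  have hsec : ∀ l : ℝ, 0 < l → (1 - κ) * (‖z‖ ^ 2 + ‖β‖ ^ 2 * l ^ 2) ≤ ‖z + l * β‖ ^ 2 := by
    intro l hl
    have := one_sub_mul_le_norm_sq hκ hz hβ him zero_le_one hl.le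
    simpa [mul_comm β] using this
  have hne : ∀ l : ℝ, 0 < l → z + l * β ≠ 0 := fun l hl h0 => by
    have := hsec l hl
    rw [h0, norm_zero] at this
    have : 0 < (1 - κ) * (‖z‖ ^ 2 + ‖β‖ ^ 2 * l ^ 2) := by positivity
    linarith
  set G : ℕ → ℂ := fun m => (z + lam m * β)⁻¹ with hG
  have hGb : ∀ m, lam m * ‖G m‖ ≤ (Real.sqrt (1 - κ) * ‖β‖)⁻¹ := fun m => by
    have h1 : 0 < ‖z + lam m * β‖ := norm_pos_iff.2 (hne _ (hlam m))
    have h2 : 0 < Real.sqrt (1 - κ) := Real.sqrt_pos.2 hκ'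
    rw [hG, norm_inv, ← div_eq_mul_inv, div_le_iff₀ h1, ← div_eq_inv_mul,
      le_div_iff₀ (by positivity)]
    refine le_of_sq_le_sq ?_ h1.le
    rw [mul_pow, mul_pow, Real.sq_sqrt hκ'.le]
    refine le_trans ?_ (hsec _ (hlam m))
    nlinarith [mul_nonneg hκ'.le (sq_nonneg ‖z‖)]
  have hGb0 : ∀ m, ‖G m‖ ≤ (lam 0)⁻¹ * (Real.sqrt (1 - κ) * ‖β‖)⁻¹ := fun m => by
    rw [← div_eq_inv_mul, le_div_iff₀ (hlam 0), mul_comm]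
    exact (mul_le_mul_of_nonneg_right (hmono m.zero_le) (norm_nonneg _)).trans (hGb m)
  obtain ⟨w₁, hw₁, -⟩ := exists_forall_inner_eq_mul e x (fun m => (G m).re)
    fun m => (Complex.abs_re_le_norm _).trans (hGb0 m)
  obtain ⟨w₂, hw₂, -⟩ := exists_forall_inner_eq_mul e x (fun m => (G m).im)
    fun m => (Complex.abs_im_le_norm _).trans (hGb0 m)
  obtain ⟨y₁, hy₁, -⟩ := exists_forall_inner_eq_mul e x (fun m => lam m * (G m).re)
    fun m => by
      rw [abs_mul, abs_of_pos (hlam m)]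
      exact (mul_le_mul_of_nonneg_left (Complex.abs_re_le_norm _) (hlam m).le).trans (hGb m)
  obtain ⟨y₂, hy₂, -⟩ := exists_forall_inner_eq_mul e x (fun m => lam m * (G m).im)
    fun m => by
      rw [abs_mul, abs_of_pos (hlam m)]
      exact (mul_le_mul_of_nonneg_left (Complex.abs_im_le_norm _) (hlam m).le).trans (hGb m)
  set D₁ : H := w₁ - ∑ j, (⟪y₁, f j⟫ / μ j) • f j with hD₁
  set D₂ : H := w₂ - ∑ j, (⟪y₂, f j⟫ / μ j) • f j with hD₂
  have hD₁n : ‖D₁‖ ^ 2 ≤ M ^ 2 * ‖y₁‖ ^ 2 := by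
    rw [← mul_pow]
    exact pow_le_pow_left₀ (norm_nonneg _) (hR y₁ w₁ fun k => by rw [hw₁, hy₁, mul_assoc]) 2
  have hD₂n : ‖D₂‖ ^ 2 ≤ M ^ 2 * ‖y₂‖ ^ 2 := by
    rw [← mul_pow]
    exact pow_le_pow_left₀ (norm_nonneg _) (hR y₂ w₂ fun k => by rw [hw₂, hy₂, mul_assoc]) 2
  set r : Fin N → ℂ := fun j => ⟨⟪y₁, f j⟫ / μ j, ⟪y₂, f j⟫ / μ j⟩ with hr
  set η : Fin N → ℂ := fun j => r j - (z + μ j * β)⁻¹ * ⟪x, f j⟫ with hη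
  set δ : Fin N → ℂ := fun j => ⟨⟪D₁, f j⟫, ⟪D₂, f j⟫⟩ with hδ
  have hηδ : ∀ j, (z + μ j * β) * η j = -z * δ j := by
    intro j
    have hμ : (μ j : ℂ) ≠ 0 := by exact_mod_cast (hf.mu_pos j).ne'
    have hω : HasSum (fun m => G m * ⟪x, e m⟫ * ⟪f j, e m⟫) (⟨⟪w₁, f j⟫, ⟪w₂, f j⟫⟩ : ℂ) := by
      rw [Complex.hasSum_iff]
      refine ⟨(hasSum_inner_mul_inner_right e w₁ (f j)).congr_fun fun m => ?_,
        (hasSum_inner_mul_inner_right e w₂ (f j)).congr_fun fun m => ?_⟩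
      · rw [hw₁]; simp
      · rw [hw₂]; simp
    have hy : HasSum (fun m => lam m * G m * ⟪x, e m⟫ * ⟪f j, e m⟫)
        (⟨⟪y₁, f j⟫, ⟪y₂, f j⟫⟩ : ℂ) := by
      rw [Complex.hasSum_iff]
      refine ⟨(hasSum_inner_mul_inner_right e y₁ (f j)).congr_fun fun m => ?_,
        (hasSum_inner_mul_inner_right e y₂ (f j)).congr_fun fun m => ?_⟩
      · rw [hy₁]; simp
      · rw [hy₂]; simp
    have hx : HasSum (fun m => ((⟪x, e m⟫ * ⟪f j, e m⟫ : ℝ) : ℂ)) ((⟪x, f j⟫ : ℝ) : ℂ) :=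
      Complex.hasSum_ofReal.2 (hasSum_inner_mul_inner_right e x (f j))
    have key := HasSum.unique (((hω.mul_left z).add (hy.mul_left β)).congr_fun
      (g := fun m => ((⟪x, e m⟫ * ⟪f j, e m⟫ : ℝ) : ℂ)) fun m => by
        have h1 : (z + lam m * β) * G m = 1 := mul_inv_cancel₀ (hne _ (hlam m))
        push_cast
        linear_combination (-(⟪x, e m⟫ : ℂ) * ⟪f j, e m⟫) * h1) hx
    have hδj : δ j = ⟨⟪w₁, f j⟫, ⟪w₂, f j⟫⟩ - r j := by
      simp only [hδ, hr, hD₁, hD₂, inner_sub_left, hf.inner_sum_smul]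
      rfl
    have hrj : (⟨⟪y₁, f j⟫, ⟪y₂, f j⟫⟩ : ℂ) = μ j * r j := by
      have := (hf.mu_pos j).ne'
      apply Complex.ext <;> simp [hr] <;> field_simp
    rw [hrj] at key
    have h2 : (z + μ j * β) * (z + μ j * β)⁻¹ = 1 := mul_inv_cancel₀ (hne _ (hf.mu_pos j))
    rw [hδj]
    simp only [hη]
    linear_combination key - (⟪x, f j⟫ : ℂ) * h2
  have hηn : ∀ j, ‖η j‖ ^ 2 ≤ (1 - κ)⁻¹ * ‖δ j‖ ^ 2 := by
    intro j
    have h1 : 0 < ‖z + μ j * β‖ := norm_pos_iff.2 (hne _ (hf.mu_pos j))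
    have h2 : ‖z + μ j * β‖ ^ 2 * ‖η j‖ ^ 2 = ‖z‖ ^ 2 * ‖δ j‖ ^ 2 := by
      rw [← mul_pow, ← norm_mul, hηδ, norm_mul, norm_neg, mul_pow]
    rw [← div_eq_inv_mul, le_div_iff₀ hκ']
    refine le_of_mul_le_mul_left (a := ‖z + μ j * β‖ ^ 2) ?_ (by positivity)
    have h3 : (1 - κ) * ‖z‖ ^ 2 ≤ ‖z + μ j * β‖ ^ 2 := by
      refine le_trans ?_ (hsec _ (hf.mu_pos j))
      nlinarith [mul_nonneg hκ'.le (mul_nonneg (sq_nonneg ‖β‖) (sq_nonneg (μ j)))]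
    calc _ = (1 - κ) * ‖z‖ ^ 2 * ‖δ j‖ ^ 2 := by rw [← mul_assoc, h2]; ring
      _ ≤ _ := mul_le_mul_of_nonneg_right h3 (sq_nonneg _)
  have hnsq : ∀ c : ℂ, ‖c‖ ^ 2 = c.re ^ 2 + c.im ^ 2 := fun c => by
    rw [Complex.sq_norm, Complex.normSq_apply]; ring
  have hbes : ∀ v : H, ∑ j, ⟪v, f j⟫ ^ 2 ≤ ‖v‖ ^ 2 := fun v => by
    have := hf.f_orth.sum_inner_products_le v (s := Finset.univ)
    simpa [real_inner_comm] using this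
  have hηsum : ∑ j, ‖η j‖ ^ 2 ≤ (1 - κ)⁻¹ * (‖D₁‖ ^ 2 + ‖D₂‖ ^ 2) := by
    calc _ ≤ ∑ j, (1 - κ)⁻¹ * ‖δ j‖ ^ 2 := Finset.sum_le_sum fun j _ => hηn j
      _ = (1 - κ)⁻¹ * (∑ j, ⟪D₁, f j⟫ ^ 2 + ∑ j, ⟪D₂, f j⟫ ^ 2) := by
        rw [← Finset.mul_sum, ← Finset.sum_add_distrib]
        simp_rw [hnsq, hδ]
      _ ≤ _ := mul_le_mul_of_nonneg_left (add_le_add (hbes _) (hbes _)) (inv_pos.2 hκ').le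
  set V₁ : H := D₁ + ∑ j, (η j).re • f j with hV₁
  set V₂ : H := D₂ + ∑ j, (η j).im • f j with hV₂
  have hE : ∀ m, ‖G m * ⟪x, e m⟫ - ∑ j, (z + μ j * β)⁻¹ * ⟪x, f j⟫ * ⟪f j, e m⟫‖ ^ 2 =
      ⟪V₁, e m⟫ ^ 2 + ⟪V₂, e m⟫ ^ 2 := by
    intro m
    have h1 : G m * ⟪x, e m⟫ - ∑ j, (z + μ j * β)⁻¹ * ⟪x, f j⟫ * ⟪f j, e m⟫ =
        (⟨⟪V₁, e m⟫, ⟪V₂, e m⟫⟩ : ℂ) := by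
      have h2 : ∀ j, (z + μ j * β)⁻¹ * ⟪x, f j⟫ = r j - η j := fun j => by simp [hη]
      simp_rw [h2]
      simp only [hV₁, hV₂, hD₁, hD₂, inner_add_left, inner_sub_left, sum_inner,
        real_inner_smul_left, hw₁, hw₂, hr]
      apply Complex.ext
      · simp [sub_mul, Finset.sum_sub_distrib]
        ring
      · simp [sub_mul, Finset.sum_sub_distrib]
        ring
    rw [h1, hnsq]
  have hpar : ∀ u v : H, ‖u + v‖ ^ 2 ≤ 2 * (‖u‖ ^ 2 + ‖v‖ ^ 2) := fun u v => by
    have := parallelogram_law_with_norm ℝ u v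
    nlinarith [sq_nonneg ‖u - v‖]
  have hVn : ‖V₁‖ ^ 2 + ‖V₂‖ ^ 2 ≤
      2 * (1 + (1 - κ)⁻¹) * M ^ 2 * (‖y₁‖ ^ 2 + ‖y₂‖ ^ 2) := by
    have h1 := hpar D₁ (∑ j, (η j).re • f j)
    have h2 := hpar D₂ (∑ j, (η j).im • f j)
    rw [hf.norm_sum_smul_sq] at h1 h2
    have h3 : ∑ j, ‖η j‖ ^ 2 = ∑ j, (η j).re ^ 2 + ∑ j, (η j).im ^ 2 := by
      rw [← Finset.sum_add_distrib]; simp_rw [hnsq]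
    have h4 : (1 + (1 - κ)⁻¹) * (‖D₁‖ ^ 2 + ‖D₂‖ ^ 2) ≤
        (1 + (1 - κ)⁻¹) * (M ^ 2 * ‖y₁‖ ^ 2 + M ^ 2 * ‖y₂‖ ^ 2) :=
      mul_le_mul_of_nonneg_left (add_le_add hD₁n hD₂n) (by positivity)
    linarith
  have hyn : ∀ m, ‖G m‖ ^ 2 * (lam m ^ 2 * ⟪x, e m⟫ ^ 2) =
      ⟪y₁, e m⟫ ^ 2 + ⟪y₂, e m⟫ ^ 2 := fun m => by rw [hy₁, hy₂, hnsq]; ring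
  have hsum : ∀ v w : H, ∑' m, ENNReal.ofReal (⟪v, e m⟫ ^ 2 + ⟪w, e m⟫ ^ 2) =
      ENNReal.ofReal (‖v‖ ^ 2 + ‖w‖ ^ 2) := fun v w => by
    rw [ENNReal.ofReal_add (sq_nonneg _) (sq_nonneg _), ofReal_norm_sq_eq_tsum e,
      ofReal_norm_sq_eq_tsum e, ← ENNReal.tsum_add]
    simp_rw [fun m => ENNReal.ofReal_add (sq_nonneg ⟪v, e m⟫) (sq_nonneg ⟪w, e m⟫)]
  simp only [hG] at hE hyn
  simp_rw [hE, hyn]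
  rw [hsum, hsum, ← ENNReal.ofReal_mul (by positivity)]
  exact ENNReal.ofReal_le_ofReal hVn

theorem inner_sop_eq {H : Type*} [NormedAddCommGroup H] [InnerProductSpace ℝ H]
    (e : HilbertBasis ℕ ℝ H) {s : ℕ → ℝ → ℝ} {t : ℝ} (hs : ∀ k, |s k t| ≤ 1) (x : H) (m : ℕ) :
    ⟪Sop e s t x, e m⟫ = s m t * ⟪x, e m⟫ := by
  obtain ⟨v, hv, hsum⟩ := exists_forall_inner_eq_mul e x (fun k => s k t) hs
  rw [Sop, hsum.tsum_eq, hv]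

theorem laplaceTransform_mul_sub_sum {N : ℕ} {s : ℝ → ℝ} {sh : Fin N → ℝ → ℝ} {z : ℂ}
    (hs : IntegrableOn (fun t => Real.exp (-z.re * t) * s t) (Ioi 0))
    (hsh : ∀ j, IntegrableOn (fun t => Real.exp (-z.re * t) * sh j t) (Ioi 0))
    (a : ℝ) (c : Fin N → ℝ) :
    laplaceTransform (fun t => s t * a - ∑ j, sh j t * c j) z =
      laplaceTransform s z * a - ∑ j, laplaceTransform (sh j) z * c j := by
  have h1 := (integrableOn_cexp_mul_of_integrableOn hs).mul_const (a : ℂ)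
  have h2 : ∀ j, IntegrableOn (fun t : ℝ => Complex.exp (-z * t) * (sh j t : ℂ) * (c j : ℂ))
      (Ioi 0) := fun j => (integrableOn_cexp_mul_of_integrableOn (hsh j)).mul_const _
  unfold laplaceTransform
  simp_rw [← integral_mul_const]
  rw [← integral_finsetSum _ fun j _ => h2 j,
    ← integral_sub h1 (integrable_finsetSum _ fun j _ => h2 j)]
  refine integral_congr_ae (.of_forall fun t => ?_)
  push_cast
  rw [mul_sub, Finset.mul_sum]
  simp only [mul_assoc]

/-- The mean square error bound for twice the order of the Ritz projection bound. -/
theorem Assumption1.exists_lintegral_error_le {b b' : ℝ → ℝ} {ρ : ℝ} (hb : Assumption1 b b' ρ)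
    {H : Type*} [NormedAddCommGroup H] [InnerProductSpace ℝ H] (e : HilbertBasis ℕ ℝ H)
    {lam : ℕ → ℝ} (hlam : ∀ k, 0 < lam k) (hmono : Monotone lam) {s s' : ℕ → ℝ → ℝ}
    (hs : ∀ k, IsScalarSolution b (lam k) (s k) (s' k)) :
    ∃ C > 0, ∀ (N : ℕ) (f : Fin N → H) (μ : Fin N → ℝ), FESetup e lam N f μ →
      ∀ M : ℝ, (∀ y w : H, (∀ k, lam k * ⟪w, e k⟫ = ⟪y, e k⟫) →
        ‖w - ∑ j, (⟪y, f j⟫ / μ j) • f j‖ ≤ M * ‖y‖) →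
      ∀ sh sh' : Fin N → ℝ → ℝ, (∀ j, IsScalarSolution b (μ j) (sh j) (sh' j)) → ∀ x : H,
        ∫⁻ t in Ioi (0 : ℝ),
            ENNReal.ofReal (‖Sop e s t x - ∑ j, (sh j t * ⟪x, f j⟫) • f j‖ ^ 2) ≤
          ENNReal.ofReal (C * M ^ 2) *
            ∑' k, ENNReal.ofReal (lam k ^ (2 - 1 / ρ) * ⟪x, e k⟫ ^ 2) := by
  obtain ⟨C, hC, hCl⟩ := hb.exists_lintegral_inv_le (hlam 0)
  set κ := Real.sin ((ρ - 1) * (Real.pi / 2)) with hκ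
  have hκ1 : κ < 1 := hb.sin_lt_one
  have hκ0 : 0 ≤ κ := by
    have h1 := hb.rho_mem.1
    have h2 := hb.rho_mem.2
    exact Real.sin_nonneg_of_nonneg_of_le_pi
      (mul_nonneg (by linarith) (by positivity)) (by nlinarith [Real.pi_pos])
  have hκ' : 0 < 1 - κ := by linarith
  refine ⟨2 * (1 + (1 - κ)⁻¹) * C, by positivity, ?_⟩
  intro N f μ hf M hR sh sh' hsh x
  set E : ℕ → ℝ → ℝ := fun m t => s m t * ⟪x, e m⟫ - ∑ j, sh j t * (⟪x, f j⟫ * ⟪f j, e m⟫)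
    with hE
  have hEm : ∀ m, AEMeasurable (E m) (volume.restrict (Ioi 0)) := fun m =>
    ((hs m).aestronglyMeasurable.aemeasurable.mul_const _).sub
      (Finset.aemeasurable_fun_sum _ fun j _ =>
        (hsh j).aestronglyMeasurable.aemeasurable.mul_const _)
  have hEn : ∀ t ∈ Ioi (0 : ℝ),
      ENNReal.ofReal (‖Sop e s t x - ∑ j, (sh j t * ⟪x, f j⟫) • f j‖ ^ 2) =
        ∑' m, ENNReal.ofReal (E m t ^ 2) := fun t ht => by
    rw [ofReal_norm_sq_eq_tsum e]
    simp_rw [inner_sub_left, inner_sop_eq e (fun k => (hs k).abs_le_one hb (hlam k) ht),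
      sum_inner, real_inner_smul_left, hE, mul_assoc]
  rw [setLIntegral_congr_fun measurableSet_Ioi hEn]
  refine lintegral_le_of_forall_exp_mul_le
    (AEMeasurable.tsum fun m => ((hEm m).pow_const 2).ennreal_ofReal)
    fun ε hε hε1 => ?_
  have hre : ∀ ω : ℝ, ((ε : ℂ) + ω * Complex.I).re = ε := fun ω => by simp
  have hre0 : ∀ ω : ℝ, 0 < ((ε : ℂ) + ω * Complex.I).re := fun ω => by rwa [hre]
  have hsi := fun m => (hs m).integrableOn_exp_mul hb (hlam m) hε
  have hshi := fun j => (hsh j).integrableOn_exp_mul hb (hf.mu_pos j) hε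
  have hEi : ∀ m, IntegrableOn (fun t => Real.exp (-ε * t) * E m t) (Ioi 0) := fun m => by
    have h := ((hsi m).mul_const ⟪x, e m⟫).sub (integrable_finsetSum Finset.univ fun j _ =>
      (hshi j).mul_const (⟪x, f j⟫ * ⟪f j, e m⟫))
    refine h.congr (.of_forall fun t => ?_)
    simp only [hE, Pi.sub_apply, mul_sub, Finset.mul_sum, mul_assoc]
  have hE2 : ∀ m, MemLp (fun t => Real.exp (-ε * t) * E m t) 2 (volume.restrict (Ioi 0)) :=
    fun m => memLp_two_of_integrableOn_of_abs_le (hEi m)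
      (K := 1 * |⟪x, e m⟫| + ∑ j, 1 * |⟪x, f j⟫ * ⟪f j, e m⟫|) fun t ht => by
        simp only [hE, mul_sub, Finset.mul_sum, ← mul_assoc _ (s m t), ← mul_assoc _ (sh _ t)]
        refine (abs_sub _ _).trans (add_le_add ?_ ((Finset.abs_sum_le_sum_abs _ _).trans
          (Finset.sum_le_sum fun j _ => ?_)))
        · rw [abs_mul]
          exact mul_le_mul_of_nonneg_right ((hs m).abs_exp_mul_le hb (hlam m) hε ht)
            (abs_nonneg _)
        · rw [abs_mul]
          exact mul_le_mul_of_nonneg_right ((hsh j).abs_exp_mul_le hb (hf.mu_pos j) hε ht)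
            (abs_nonneg _)
  have hL : ∀ (ω : ℝ) m, laplaceTransform (E m) (ε + ω * Complex.I) =
      ((ε + ω * Complex.I) + lam m * laplaceTransform b (ε + ω * Complex.I))⁻¹ * ⟪x, e m⟫ -
        ∑ j, ((ε + ω * Complex.I) + μ j * laplaceTransform b (ε + ω * Complex.I))⁻¹ *
          ⟪x, f j⟫ * ⟪f j, e m⟫ := fun ω m => by
    rw [hE, laplaceTransform_mul_sub_sum (by rw [hre]; exact hsi m)
      (fun j => by rw [hre]; exact hshi j), (hs m).laplaceTransform_eq hb (hlam m) (hre0 ω)]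
    simp_rw [fun j => (hsh j).laplaceTransform_eq hb (hf.mu_pos j) (hre0 ω)]
    push_cast
    simp_rw [mul_assoc]
  have hbc : Continuous fun ω : ℝ => laplaceTransform b (ε + ω * Complex.I) :=
    continuous_laplaceTransform_vertical (hb.integrableOn_exp_mul hε)
  have hpi : (1 : ℝ) ≤ 2 * Real.pi := by linarith [Real.pi_gt_three]
  calc ∫⁻ t in Ioi 0, ENNReal.ofReal (Real.exp (-ε * t) ^ 2) * ∑' m, ENNReal.ofReal (E m t ^ 2)
      = ∑' m, ∫⁻ t in Ioi 0, ENNReal.ofReal ((Real.exp (-ε * t) * E m t) ^ 2) := by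
        rw [← lintegral_tsum fun m =>
          ((hEi m).aestronglyMeasurable.aemeasurable.pow_const 2).ennreal_ofReal]
        simp_rw [← ENNReal.tsum_mul_left, ← ENNReal.ofReal_mul (sq_nonneg (Real.exp _)), mul_pow]
    _ ≤ ∑' m, ∫⁻ ω : ℝ, ‖laplaceTransform (E m) (ε + ω * Complex.I)‖ₑ ^ 2 :=
        ENNReal.tsum_le_tsum fun m => by
          rw [lintegral_enorm_laplaceTransform_sq (hEi m) (hE2 m)]
          exact le_mul_of_one_le_left' (ENNReal.one_le_ofReal.2 hpi)
    _ = ∫⁻ ω : ℝ, ∑' m, ‖laplaceTransform (E m) (ε + ω * Complex.I)‖ₑ ^ 2 :=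
        (lintegral_tsum fun m =>
          ((continuous_laplaceTransform_vertical (hEi m)).measurable.enorm.pow_const
            2).aemeasurable).symm
    _ ≤ ∫⁻ ω : ℝ, ENNReal.ofReal (2 * (1 + (1 - κ)⁻¹) * M ^ 2) *
          ∑' m, ‖((ε + ω * Complex.I) + lam m * laplaceTransform b (ε + ω * Complex.I))⁻¹‖ₑ ^ 2 *
            ENNReal.ofReal (lam m ^ 2 * ⟪x, e m⟫ ^ 2) := by
        refine lintegral_mono fun ω => ?_
        have h := hf.tsum_norm_sub_sq_le hlam hmono hR hκ0 hκ1 (hre0 ω).le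
          (hb.re_nonneg (hre0 ω)) (hb.laplaceTransform_ne_zero (hre0 ω))
          (hb.abs_im_le (hre0 ω)) x
        simp_rw [← hL, fun y : ℂ => ENNReal.ofReal_pow (norm_nonneg y) 2, fun (y : ℂ) (a : ℝ) =>
          ENNReal.ofReal_mul (p := ‖y‖ ^ 2) (q := a) (sq_nonneg _),
          fun y : ℂ => ENNReal.ofReal_pow (norm_nonneg y) 2, ofReal_norm] at h
        exact h
    _ = ENNReal.ofReal (2 * (1 + (1 - κ)⁻¹) * M ^ 2) * ∑' m, (∫⁻ ω : ℝ,
          ‖((ε + ω * Complex.I) + lam m * laplaceTransform b (ε + ω * Complex.I))⁻¹‖ₑ ^ 2) *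
            ENNReal.ofReal (lam m ^ 2 * ⟪x, e m⟫ ^ 2) := by
        have hm : ∀ m, Measurable fun ω : ℝ => ‖((ε + ω * Complex.I) +
            lam m * laplaceTransform b (ε + ω * Complex.I))⁻¹‖ₑ ^ 2 := fun m => by
          have := hbc.measurable
          fun_prop
        rw [lintegral_const_mul' _ _ ENNReal.ofReal_ne_top,
          lintegral_tsum fun m => ((hm m).mul_const _).aemeasurable]
        exact congrArg _ (tsum_congr fun m => lintegral_mul_const _ (hm m))
    _ ≤ ENNReal.ofReal (2 * (1 + (1 - κ)⁻¹) * M ^ 2) * ∑' m,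
          ENNReal.ofReal (C * lam m ^ (-(1 / ρ))) *
            ENNReal.ofReal (lam m ^ 2 * ⟪x, e m⟫ ^ 2) := by
        gcongr with m
        exact hCl _ (hmono m.zero_le) ε hε hε1
    _ = _ := by
        have h1 : ∀ m, ENNReal.ofReal (C * lam m ^ (-(1 / ρ))) *
            ENNReal.ofReal (lam m ^ 2 * ⟪x, e m⟫ ^ 2) =
              ENNReal.ofReal C * ENNReal.ofReal (lam m ^ (2 - 1 / ρ) * ⟪x, e m⟫ ^ 2) := by
          intro m
          have := Real.rpow_pos_of_pos (hlam m) (-(1 / ρ))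
          rw [← ENNReal.ofReal_mul (by positivity), ← ENNReal.ofReal_mul hC.le,
            sub_eq_add_neg, Real.rpow_add (hlam m), Real.rpow_two]
          congr 1
          ring
        simp_rw [h1, ENNReal.tsum_mul_left]
        rw [← mul_assoc, ← ENNReal.ofReal_mul (by positivity)]
        congr 2
        ring

theorem ofReal_norm_sub_sq_le {H : Type*} [NormedAddCommGroup H] [InnerProductSpace ℝ H]
    (u v : H) : ENNReal.ofReal (‖u - v‖ ^ 2) ≤
      2 * ENNReal.ofReal (‖u‖ ^ 2) + 2 * ENNReal.ofReal (‖v‖ ^ 2) := by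
  rw [← mul_add, ← ENNReal.ofReal_add (sq_nonneg _) (sq_nonneg _),
    ← ENNReal.ofReal_ofNat 2, ← ENNReal.ofReal_mul zero_le_two]
  refine ENNReal.ofReal_le_ofReal ?_
  have := parallelogram_law_with_norm ℝ u v
  nlinarith [sq_nonneg ‖u + v‖]

/-- The mean square error bound for rough initial data. -/
theorem Assumption1.exists_lintegral_error_le_of_rough {b b' : ℝ → ℝ} {ρ : ℝ}
    (hb : Assumption1 b b' ρ)
    {H : Type*} [NormedAddCommGroup H] [InnerProductSpace ℝ H] (e : HilbertBasis ℕ ℝ H)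
    {lam : ℕ → ℝ} (hlam : ∀ k, 0 < lam k) (hmono : Monotone lam) {s s' : ℕ → ℝ → ℝ}
    (hs : ∀ k, IsScalarSolution b (lam k) (s k) (s' k)) :
    ∃ C > 0, ∀ (N : ℕ) (f : Fin N → H) (μ : Fin N → ℝ), FESetup e lam N f μ →
      ∀ sh sh' : Fin N → ℝ → ℝ, (∀ j, IsScalarSolution b (μ j) (sh j) (sh' j)) → ∀ x : H,
        ∫⁻ t in Ioi (0 : ℝ),
            ENNReal.ofReal (‖Sop e s t x - ∑ j, (sh j t * ⟪x, f j⟫) • f j‖ ^ 2) ≤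
          ENNReal.ofReal C * ∑' k, ENNReal.ofReal (lam k ^ (-(1 / ρ)) * ⟪x, e k⟫ ^ 2) := by
  obtain ⟨C, hC, hCl⟩ := hb.exists_lintegral_sq_le (hlam 0)
  have hα : 1 / ρ ∈ Ioo (0 : ℝ) 1 := by
    have h1 := hb.rho_mem.1
    exact ⟨by positivity, (div_lt_one (by linarith)).2 h1⟩
  refine ⟨2 * C + 2 * C, by positivity, fun N f μ hf sh sh' hsh x => ?_⟩
  have hstep : ∀ l : ℝ, lam 0 ≤ l → ∀ r r' : ℝ → ℝ, IsScalarSolution b l r r' → ∀ a : ℝ,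
      ∫⁻ t in Ioi 0, ENNReal.ofReal ((r t * a) ^ 2) ≤
        ENNReal.ofReal C * ENNReal.ofReal (l ^ (-(1 / ρ)) * a ^ 2) := by
    intro l hl r r' hr a
    have hl0 : 0 < l := (hlam 0).trans_le hl
    simp_rw [mul_pow, fun t => ENNReal.ofReal_mul (q := a ^ 2) (sq_nonneg (r t))]
    rw [lintegral_mul_const' _ _ ENNReal.ofReal_ne_top,
      ENNReal.ofReal_mul (Real.rpow_pos_of_pos hl0 _).le, ← mul_assoc, ← ENNReal.ofReal_mul hC.le]
    exact mul_le_mul_left (hCl l hl r r' hr) _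
  have hm1 : ∀ m, AEMeasurable (fun t => ENNReal.ofReal ((s m t * ⟪x, e m⟫) ^ 2))
      (volume.restrict (Ioi 0)) := fun m =>
    (((hs m).aestronglyMeasurable.aemeasurable.mul_const _).pow_const 2).ennreal_ofReal
  have hm2 : ∀ j, AEMeasurable (fun t => ENNReal.ofReal ((sh j t * ⟪x, f j⟫) ^ 2))
      (volume.restrict (Ioi 0)) := fun j =>
    (((hsh j).aestronglyMeasurable.aemeasurable.mul_const _).pow_const 2).ennreal_ofReal
  have hpt : ∀ t ∈ Ioi (0 : ℝ),
      ENNReal.ofReal (‖Sop e s t x - ∑ j, (sh j t * ⟪x, f j⟫) • f j‖ ^ 2) ≤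
        2 * ∑' m, ENNReal.ofReal ((s m t * ⟪x, e m⟫) ^ 2) +
          2 * ∑ j, ENNReal.ofReal ((sh j t * ⟪x, f j⟫) ^ 2) := by
    intro t ht
    have h1 : ENNReal.ofReal (‖Sop e s t x‖ ^ 2) =
        ∑' m, ENNReal.ofReal ((s m t * ⟪x, e m⟫) ^ 2) := by
      rw [ofReal_norm_sq_eq_tsum e]
      simp_rw [inner_sop_eq e (fun k => (hs k).abs_le_one hb (hlam k) ht)]
    rw [← h1, ← ENNReal.ofReal_sum_of_nonneg fun j _ => sq_nonneg _, ← hf.norm_sum_smul_sq]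
    exact ofReal_norm_sub_sq_le _ _
  calc _ ≤ ∫⁻ t in Ioi (0 : ℝ), (2 * ∑' m, ENNReal.ofReal ((s m t * ⟪x, e m⟫) ^ 2) +
          2 * ∑ j, ENNReal.ofReal ((sh j t * ⟪x, f j⟫) ^ 2)) :=
        setLIntegral_mono' measurableSet_Ioi hpt
    _ = 2 * ∑' m, (∫⁻ t in Ioi (0 : ℝ), ENNReal.ofReal ((s m t * ⟪x, e m⟫) ^ 2)) +
          2 * ∑ j, ∫⁻ t in Ioi (0 : ℝ), ENNReal.ofReal ((sh j t * ⟪x, f j⟫) ^ 2) := by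
        rw [lintegral_add_left' ((AEMeasurable.tsum hm1).const_mul 2),
          lintegral_const_mul' _ _ ENNReal.ofNat_ne_top,
          lintegral_const_mul' _ _ ENNReal.ofNat_ne_top, lintegral_tsum hm1,
          lintegral_finsetSum' _ fun j _ => hm2 j]
    _ ≤ 2 * ∑' m, ENNReal.ofReal C * ENNReal.ofReal (lam m ^ (-(1 / ρ)) * ⟪x, e m⟫ ^ 2) +
          2 * ∑ j, ENNReal.ofReal C * ENNReal.ofReal (μ j ^ (-(1 / ρ)) * ⟪x, f j⟫ ^ 2) := by
        gcongr with m j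
        · exact hstep _ (hmono m.zero_le) _ _ (hs m) _
        · exact hstep _ (hf.le_mu hlam hmono j) _ _ (hsh j) _
    _ ≤ _ := by
        rw [ENNReal.tsum_mul_left, ← Finset.mul_sum, ENNReal.ofReal_add (by positivity)
          (by positivity), ENNReal.ofReal_mul zero_le_two, ENNReal.ofReal_ofNat, add_mul,
          mul_assoc]
        gcongr
        exact hf.sum_rpow_le hlam hα x

theorem sop_sub {H : Type*} [NormedAddCommGroup H] [InnerProductSpace ℝ H]
    (e : HilbertBasis ℕ ℝ H) {s : ℕ → ℝ → ℝ} {t : ℝ} (hs : ∀ k, |s k t| ≤ 1) (x y : H) :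
    Sop e s t (x - y) = Sop e s t x - Sop e s t y := by
  obtain ⟨v, -, hv⟩ := exists_forall_inner_eq_mul e x (fun k => s k t) hs
  obtain ⟨w, -, hw⟩ := exists_forall_inner_eq_mul e y (fun k => s k t) hs
  rw [Sop, Sop, Sop, hv.tsum_eq, hw.tsum_eq]
  refine ((hv.sub hw).congr_fun fun k => ?_).tsum_eq
  rw [inner_sub_left, mul_sub, sub_smul]

theorem aemeasurable_ofReal_norm_sq {H : Type*} [NormedAddCommGroup H] [InnerProductSpace ℝ H]
    (e : HilbertBasis ℕ ℝ H) {ν : Measure ℝ} {v : ℝ → H}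
    (hv : ∀ m, AEMeasurable (fun t => ⟪v t, e m⟫) ν) :
    AEMeasurable (fun t => ENNReal.ofReal (‖v t‖ ^ 2)) ν := by
  simp_rw [ofReal_norm_sq_eq_tsum e]
  exact AEMeasurable.tsum fun m => ((hv m).pow_const 2).ennreal_ofReal

/-- the `L²((0,∞);H)` error estimate for the spatially semidiscrete
deterministic problem: `∫₀^∞ ‖S(t)x - S_h(t)P_h x‖² dt ≤ C h^{2s} ‖x‖²_{s-1/ρ}`
for `0 ≤ s ≤ 2`, with `C` independent of `h` and `x` (given the Ritz projection
error constant `CR`). -/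
theorem statement8 {H : Type*} [NormedAddCommGroup H] [InnerProductSpace ℝ H]
    [CompleteSpace H]
    (b b' : ℝ → ℝ) (ρ : ℝ) (hb : Assumption1 b b' ρ)
    (e : HilbertBasis ℕ ℝ H) (lam : ℕ → ℝ)
    (hlam_pos : ∀ k, 0 < lam k) (hlam_mono : Monotone lam)
    (hlam_top : Tendsto lam atTop atTop)
    (s s' : ℕ → ℝ → ℝ) (hs : ∀ k, IsScalarSolution b (lam k) (s k) (s' k))
    (CR : ℝ) (hCR : 0 < CR) :
    ∃ C > 0, ∀ h : ℝ, 0 < h →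
      ∀ (N : ℕ) (f : Fin N → H) (μ : Fin N → ℝ), FESetup e lam N f μ →
      ∀ Rh : H → H,
        (∀ v : H, Rh v ∈ Submodule.span ℝ (Set.range f)) →
        (∀ v : H, (∑' k, ENNReal.ofReal (lam k * ⟪v, e k⟫ ^ 2)) < ⊤ →
          ∀ j, (∑' k, lam k * ⟪Rh v - v, e k⟫ * ⟪f j, e k⟫) = 0) →
        (∀ γ ∈ Set.Icc (1 : ℝ) 2, ∀ v : H,
          (∑' k, ENNReal.ofReal (lam k ^ γ * ⟪v, e k⟫ ^ 2)) < ⊤ →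
          ‖Rh v - v‖ ≤ CR * h ^ γ * Real.sqrt (∑' k, lam k ^ γ * ⟪v, e k⟫ ^ 2)) →
      ∀ sh sh' : Fin N → ℝ → ℝ, (∀ j, IsScalarSolution b (μ j) (sh j) (sh' j)) →
      ∀ σ ∈ Set.Icc (0 : ℝ) 2, ∀ x : H,
        (∫⁻ t in Set.Ioi (0 : ℝ),
            ENNReal.ofReal (‖Sop e s t x - ∑ j, (sh j t * ⟪x, f j⟫) • f j‖ ^ 2)) ≤
          ENNReal.ofReal (C * h ^ (2 * σ)) *
            ∑' k, ENNReal.ofReal (lam k ^ (σ - 1 / ρ) * ⟪x, e k⟫ ^ 2) := by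
  obtain ⟨C₁, hC₁, h₁⟩ := hb.exists_lintegral_error_le e hlam_pos hlam_mono hs
  obtain ⟨C₂, hC₂, h₂⟩ := hb.exists_lintegral_error_le_of_rough e hlam_pos hlam_mono hs
  refine ⟨2 * (C₁ * CR ^ 2) + 2 * C₂, by positivity, ?_⟩
  intro h hh N f μ hf Rh hspan horth hbound sh sh' hsh σ hσ x
  -- Split `x` at the frequency `λ h² = 1`.
  set c : ℕ → ℝ := fun k => if lam k * h ^ 2 ≤ 1 then 1 else 0 with hc
  obtain ⟨y, hy, -⟩ := exists_forall_inner_eq_mul e x c (M := 1) fun k => by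
    simp only [hc]; split_ifs <;> simp
  have hlow := h₁ N f μ hf (CR * h ^ 2)
    (fun _ _ => hf.norm_sub_sum_le hlam_pos hlam_mono hspan horth hbound) sh sh' hsh y
  have hhigh := h₂ N f μ hf sh sh' hsh (y - x)
  set B := ENNReal.ofReal (h ^ (2 * σ)) *
    ∑' k, ENNReal.ofReal (lam k ^ (σ - 1 / ρ) * ⟪x, e k⟫ ^ 2) with hB
  have hpow : ∀ k, h ^ (2 * σ) * lam k ^ (σ - 1 / ρ) =
      (lam k * h ^ 2) ^ σ * lam k ^ (-(1 / ρ)) := fun k => by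
    rw [Real.mul_rpow (hlam_pos k).le (sq_nonneg h), sub_eq_add_neg, Real.rpow_add (hlam_pos k),
      Real.rpow_mul hh.le, Real.rpow_two]
    ring
  have hterm : ∀ (k : ℕ) (a : ℝ), a ≤ (lam k * h ^ 2) ^ σ →
      ENNReal.ofReal (a * (lam k ^ (-(1 / ρ)) * ⟪x, e k⟫ ^ 2)) ≤
        ENNReal.ofReal (h ^ (2 * σ)) *
          ENNReal.ofReal (lam k ^ (σ - 1 / ρ) * ⟪x, e k⟫ ^ 2) := fun k a ha => by
    have h0 := Real.rpow_pos_of_pos (hlam_pos k) (-(1 / ρ))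
    rw [← ENNReal.ofReal_mul (Real.rpow_pos_of_pos hh _).le, ← mul_assoc, ← mul_assoc, hpow]
    refine ENNReal.ofReal_le_ofReal ?_
    gcongr
  have hq : ∀ k, 0 < lam k * h ^ 2 := fun k => mul_pos (hlam_pos k) (pow_pos hh 2)
  have hlow' : ENNReal.ofReal (C₁ * (CR * h ^ 2) ^ 2) *
      ∑' k, ENNReal.ofReal (lam k ^ (2 - 1 / ρ) * ⟪y, e k⟫ ^ 2) ≤
        ENNReal.ofReal (C₁ * CR ^ 2) * B := by
    rw [mul_pow, ← mul_assoc, ENNReal.ofReal_mul (by positivity), mul_assoc, hB]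
    refine mul_le_mul_right ?_ _
    rw [← ENNReal.tsum_mul_left, ← ENNReal.tsum_mul_left]
    refine ENNReal.tsum_le_tsum fun k => le_trans (le_of_eq ?_) (hterm k (c k ^ 2 * (lam k * h ^ 2) ^ 2) ?_)
    · rw [← ENNReal.ofReal_mul (by positivity), hy, sub_eq_add_neg, Real.rpow_add (hlam_pos k),
        Real.rpow_two]
      congr 1
      ring
    · simp only [hc]
      split_ifs with hk
      · rw [one_pow, one_mul, ← Real.rpow_two]
        exact Real.rpow_le_rpow_of_exponent_ge (hq k) hk hσ.2
      · simpa using (Real.rpow_pos_of_pos (hq k) σ).le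
  have hhigh' : ∑' k, ENNReal.ofReal (lam k ^ (-(1 / ρ)) * ⟪y - x, e k⟫ ^ 2) ≤ B := by
    rw [hB, ← ENNReal.tsum_mul_left]
    refine ENNReal.tsum_le_tsum fun k => le_trans (le_of_eq ?_) (hterm k ((c k - 1) ^ 2) ?_)
    · rw [inner_sub_left, hy]
      congr 1
      ring
    · simp only [hc]
      split_ifs with hk
      · simpa using (Real.rpow_pos_of_pos (hq k) σ).le
      · simpa using Real.one_le_rpow (not_le.1 hk).le hσ.1
  have hs1 : ∀ t ∈ Ioi (0 : ℝ), ∀ k, |s k t| ≤ 1 := fun t ht k =>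
    (hs k).abs_le_one hb (hlam_pos k) ht
  have hmeas : AEMeasurable (fun t => ENNReal.ofReal
      (‖Sop e s t y - ∑ j, (sh j t * ⟪y, f j⟫) • f j‖ ^ 2)) (volume.restrict (Ioi 0)) := by
    refine aemeasurable_ofReal_norm_sq e fun m => ?_
    simp_rw [inner_sub_left, sum_inner, real_inner_smul_left]
    refine AEMeasurable.sub ?_ (Finset.aemeasurable_fun_sum _ fun j _ =>
      ((hsh j).aestronglyMeasurable.aemeasurable.mul_const _).mul_const _)
    refine ((hs m).aestronglyMeasurable.aemeasurable.mul_const ⟪y, e m⟫).congr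
      ((ae_restrict_iff' measurableSet_Ioi).2 (.of_forall fun t ht => ?_))
    exact (inner_sop_eq e (hs1 t ht) y m).symm
  calc _ ≤ ∫⁻ t in Ioi (0 : ℝ),
        (2 * ENNReal.ofReal (‖Sop e s t y - ∑ j, (sh j t * ⟪y, f j⟫) • f j‖ ^ 2) +
          2 * ENNReal.ofReal
            (‖Sop e s t (y - x) - ∑ j, (sh j t * ⟪y - x, f j⟫) • f j‖ ^ 2)) := by
        refine setLIntegral_mono' measurableSet_Ioi fun t ht => ?_
        refine le_trans (le_of_eq ?_) (ofReal_norm_sub_sq_le _ _)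
        congr 3
        rw [sop_sub e (hs1 t ht)]
        simp_rw [inner_sub_left, mul_sub, sub_smul, Finset.sum_sub_distrib]
        abel
    _ ≤ 2 * (ENNReal.ofReal (C₁ * CR ^ 2) * B) + 2 * (ENNReal.ofReal C₂ * B) := by
        rw [lintegral_add_left' (hmeas.const_mul 2),
          lintegral_const_mul' _ _ ENNReal.ofNat_ne_top,
          lintegral_const_mul' _ _ ENNReal.ofNat_ne_top]
        exact add_le_add (mul_le_mul_right (hlow.trans hlow') _)
          (mul_le_mul_right (hhigh.trans (mul_le_mul_right hhigh' _)) _)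
    _ = _ := by
        rw [hB, ENNReal.ofReal_mul (q := h ^ (2 * σ)) (by positivity), ENNReal.ofReal_add (by positivity)
          (by positivity), ENNReal.ofReal_mul zero_le_two, ENNReal.ofReal_mul zero_le_two,
          ENNReal.ofReal_ofNat]
        ring
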